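/- arXiv:1711.03923 — 3 statements merged into one kernel-verified Lean document; each statement's English description precedes it below -/
import Mathlib

section
/- For all m, n ≥ 1, the area word map is a bijection between the set of m×n reduced parallelogram polyominoes and the set of Dyck words of length m+n+1 in the ordered alphabet 0 < 0̄ < 1 < 1̄ < 2 < 2̄ < ⋯ that begin with the letter 0 and contain exactly m+1 unbarred letters and exactly n barred letters. (A Dyck word in this alphabet is a word each of whose letters is less than or equal to the successor in the alphabet of the letter immediately preceding it.) -/
open Finset

/- ## Reduced parallelogram polyominoes

Letters of the ordered alphabet `0 < 0̄ < 1 < 1̄ < 2 < 2̄ < ⋯` are encoded as natural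
numbers: the letter with numeric value `v` is encoded as `2*v` if unbarred and as
`2*v+1` if barred.  With this encoding the order of the alphabet is the order of `ℕ`,
the successor in the alphabet is `+1`, the numeric value of a letter `c` is `c / 2`,
and a letter is barred iff `c % 2 = 1`. -/

/-- A reduced parallelogram polyomino of size `m × n`: a pair of `{0,1}`-sequences
(`true` = north step, `false` = east step) of length `m+n`, each with `n` north steps,
the red path staying weakly above the green one. -/
structure RedPoly (m n : ℕ) where
  red : Fin (m + n) → Bool
  green : Fin (m + n) → Bool
  red_count : (univ.filter fun i => red i = true).card = n
  green_count : (univ.filter fun i => green i = true).card = n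
  green_le_red : ∀ i : Fin (m + n),
    (univ.filter fun j => j ≤ i ∧ green j = true).card ≤
    (univ.filter fun j => j ≤ i ∧ red j = true).card

/-- Number of `true` entries strictly before position `j`. -/
def truesBefore {N : ℕ} (p : Fin N → Bool) (j : Fin N) : ℕ :=
  (univ.filter fun l => l < j ∧ p l = true).card

/-- Number of `false` entries strictly before position `j`. -/
def falsesBefore {N : ℕ} (p : Fin N → Bool) (j : Fin N) : ℕ :=
  (univ.filter fun l => l < j ∧ p l = false).card

/-- The height of the lattice path `p` over the column `[x, x+1]`, i.e. the number of
north steps occurring before the `(x+1)`-st east step. -/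
def heightAt {N : ℕ} (p : Fin N → Bool) (x : ℕ) : ℕ :=
  (univ.filter fun j => p j = true ∧ falsesBefore p j ≤ x).card

/-- The `x`-coordinate at which the lattice path `p` makes its north step from height
`y` to height `y+1`, i.e. the number of east steps occurring before the `(y+1)`-st
north step. -/
def xcoordAt {N : ℕ} (p : Fin N → Bool) (y : ℕ) : ℕ :=
  (univ.filter fun j => p j = false ∧ truesBefore p j ≤ y).card

/-- Reading a sequence of northeast (`true`) / southeast (`false`) steps starting at
height `h`, record for each northeast step the (encoded) letter of the level at which
it ends: a northeast step from height `h` to `h+1` ends at level `h+1`, whose letter is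
the `(h+1)`-st letter of the alphabet, encoded as `h`. -/
def areaWordAux : ℕ → List Bool → List ℕ
  | _, [] => []
  | h, true :: rest => h :: areaWordAux (h + 1) rest
  | h, false :: rest => areaWordAux (h - 1) rest

/-- The interlaced Dyck path `D = (1, r₁, 1-g₁, r₂, 1-g₂, …, r_{m+n}, 1-g_{m+n}, 0)`. -/
def interlaced {m n : ℕ} (P : RedPoly m n) : List Bool :=
  true :: ((List.ofFn fun i : Fin (m + n) => [P.red i, !P.green i]).flatten ++ [false])

/-- The area word of a reduced parallelogram polyomino (letters encoded in `ℕ`). -/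
def areaWord {m n : ℕ} (P : RedPoly m n) : List ℕ :=
  areaWordAux 0 (interlaced P)

/-- `area`: the sum of the numeric values of the letters of the area word. -/
def areaStat {m n : ℕ} (P : RedPoly m n) : ℕ :=
  ((areaWord P).map fun c => c / 2).sum

/-- `dinv`: the number of pairs of positions `i < j` in the area word such that the
letter in position `i` is the successor (in the alphabet) of the letter in position `j`. -/
def dinvStat {m n : ℕ} (P : RedPoly m n) : ℕ :=
  ((Finset.range (areaWord P).length ×ˢ Finset.range (areaWord P).length).filter
    fun p => p.1 < p.2 ∧ (areaWord P).getD p.1 0 = (areaWord P).getD p.2 0 + 1).card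

/-- `d` is the position of the unbarred letter of a rise of the word `w`: the letter at
position `d-1` is barred and the letter at position `d` is its successor in the
alphabet. -/
def IsRise (w : List ℕ) (d : ℕ) : Prop :=
  0 < d ∧ d < w.length ∧ w.getD (d - 1) 0 % 2 = 1 ∧ w.getD d 0 = w.getD (d - 1) 0 + 1

/-- An `m × n` reduced parallelogram polyomino with `k` decorated rises (the marks
record the positions of the unbarred letters of the marked rises in the area word). -/
structure RiseDecorated (m n k : ℕ) where
  poly : RedPoly m n
  marks : Finset ℕ
  marks_card : marks.card = k
  marks_rise : ∀ d ∈ marks, IsRise (areaWord poly) d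

/-- `underlined-area`: the sum of the numeric values of the letters of the area word,
the marked letters excepted. -/
def uArea {m n k : ℕ} (Q : RiseDecorated m n k) : ℕ :=
  ∑ i ∈ Finset.range (areaWord Q.poly).length \ Q.marks, (areaWord Q.poly).getD i 0 / 2

/-- The corner points of the bounce path: `bouncePt P k = (X k, Y k)` where the
`(k+1)`-st vertical run goes from height `Y k` up to `Y (k+1)` (the height at which the
red path makes its east step over the current column), and the `(k+1)`-st horizontal
run goes from `X k` to `X (k+1)` (the `x`-coordinate at which the green path makes its
north step from the current height). -/
def bouncePt {m n : ℕ} (P : RedPoly m n) : ℕ → ℕ × ℕ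
  | 0 => (0, 0)
  | k + 1 =>
    (xcoordAt P.green (heightAt P.red (bouncePt P k).1),
     heightAt P.red (bouncePt P k).1)

/-- The numeric value of the label of the vertical step of the bounce path in row `y`
(the vertical steps of the `(k+1)`-st vertical run carry the unbarred letter `k`). -/
def vertLabel {m n : ℕ} (P : RedPoly m n) (y : ℕ) : ℕ :=
  ((Finset.range (m + n)).filter fun k => (bouncePt P (k + 1)).2 ≤ y).card

/-- The numeric value of the label of the horizontal step of the bounce path in column
`x` (the horizontal steps of the `(k+1)`-st horizontal run carry the barred letter `k̄`). -/
def horLabel {m n : ℕ} (P : RedPoly m n) (x : ℕ) : ℕ :=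
  ((Finset.range (m + n)).filter fun k => (bouncePt P (k + 1)).1 ≤ x).card

/-- `bounce`: the sum of the numeric values of the labels of the bounce path. -/
def bounceStat {m n : ℕ} (P : RedPoly m n) : ℕ :=
  (∑ y ∈ Finset.range n, vertLabel P y) + ∑ x ∈ Finset.range m, horLabel P x

/-- The number of labels of the bounce path equal to the (unbarred) letter `0`. -/
def zeroLabelCount {m n : ℕ} (P : RedPoly m n) : ℕ :=
  ((Finset.range n).filter fun y => vertLabel P y = 0).card

/-- A red valley: a north step of the red path preceded by an east step. -/
def IsRedValley {m n : ℕ} (P : RedPoly m n) (j : Fin (m + n)) : Prop :=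
  P.red j = true ∧ ∃ i : Fin (m + n), (i : ℕ) + 1 = (j : ℕ) ∧ P.red i = false

/-- The row (counted from `0`) occupied by the north step `j` of the red path. -/
def rowOf {m n : ℕ} (P : RedPoly m n) (j : Fin (m + n)) : ℕ :=
  truesBefore P.red j

/-- An `m × n` reduced parallelogram polyomino with `k` decorated red valleys. -/
structure ValleyDecorated (m n k : ℕ) where
  poly : RedPoly m n
  marks : Finset (Fin (m + n))
  marks_card : marks.card = k
  marks_valley : ∀ j ∈ marks, IsRedValley poly j

/-- `underlined-bounce`: the sum of the numeric values of the labels of the bounce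
path, excluding the labels of the bounce-path steps lying in the same row as a marked
valley. -/
def uBounce {m n k : ℕ} (Q : ValleyDecorated m n k) : ℕ :=
  (∑ y ∈ Finset.range n \ Q.marks.image (rowOf Q.poly), vertLabel Q.poly y) +
    ∑ x ∈ Finset.range m, horLabel Q.poly x

/- ## q,t-enumerators -/

/-- `q`, as an element of `ℤ[q,t] = MvPolynomial (Fin 2) ℤ`. -/
noncomputable def Xq : MvPolynomial (Fin 2) ℤ := MvPolynomial.X 0

/-- `t`, as an element of `ℤ[q,t] = MvPolynomial (Fin 2) ℤ`. -/
noncomputable def Xt : MvPolynomial (Fin 2) ℤ := MvPolynomial.X 1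

/-- The Gaussian `q`-binomial coefficient `[a choose b]_x`, defined by the `q`-Pascal
recursion `[a+1 choose b+1] = [a choose b] + x^(b+1) * [a choose b+1]`. -/
def qbinom {R : Type*} [CommSemiring R] (x : R) : ℕ → ℕ → R
  | _, 0 => 1
  | 0, _ + 1 => 0
  | a + 1, b + 1 => qbinom x a b + x ^ (b + 1) * qbinom x a (b + 1)

/-- `RPqt•(m,n;s;k)`: the `(area, underlined-bounce)` `q,t`-enumerator of `m × n`
reduced polyominoes with `k` decorated red valleys whose bounce path carries exactly
`s-1` labels equal to the letter `0`. -/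
noncomputable def RPbullet (m n s k : ℕ) : MvPolynomial (Fin 2) ℤ :=
  ∑ᶠ Q : ValleyDecorated m n k,
    if zeroLabelCount Q.poly + 1 = s then Xq ^ areaStat Q.poly * Xt ^ uBounce Q else 0

/-- `RPqt★(a,b;s;k)`: the `(dinv, underlined-area)` `q,t`-enumerator of `a × b` reduced
polyominoes with `k` decorated rises whose area word contains exactly `s` letters equal
to the unbarred letter `0`. -/
noncomputable def RPstar (a b s k : ℕ) : MvPolynomial (Fin 2) ℤ :=
  ∑ᶠ Q : RiseDecorated a b k,
    if (areaWord Q.poly).count 0 = s then Xq ^ dinvStat Q.poly * Xt ^ uArea Q else 0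

/- ## Two cars parking functions -/

/-- A two-cars parking function of size `N`, encoded by its area word `a` and its
labels `l`: `a` is the area word of a Dyck path (`a₀ = 0` and `a` increases by at most
`1` at each step), the labels are `1` or `2` and strictly increase bottom to top within
each column (two consecutive north steps lie in the same column exactly when the area
word increases by `1`). -/
structure TwoCarsPF (N : ℕ) where
  a : Fin N → ℕ
  l : Fin N → ℕ
  a_first : ∀ i : Fin N, (i : ℕ) = 0 → a i = 0
  a_step : ∀ i j : Fin N, (i : ℕ) + 1 = (j : ℕ) → a j ≤ a i + 1
  col_incr : ∀ i j : Fin N, (i : ℕ) + 1 = (j : ℕ) → a j = a i + 1 → l i < l j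
  l_one_le : ∀ i, 1 ≤ l i
  l_le_two : ∀ i, l i ≤ 2

/-- `dinv` of a (two-cars) parking function. -/
def pfDinv {N : ℕ} (F : TwoCarsPF N) : ℕ :=
  (univ.filter fun p : Fin N × Fin N =>
    p.1 < p.2 ∧ ((F.a p.1 = F.a p.2 ∧ F.l p.1 < F.l p.2) ∨
      (F.a p.1 = F.a p.2 + 1 ∧ F.l p.2 < F.l p.1))).card

/-- A rise of a parking function: an index whose area word entry is one more than the
previous one. -/
def IsPFRise {N : ℕ} (F : TwoCarsPF N) (i : Fin N) : Prop :=
  ∃ j : Fin N, (j : ℕ) + 1 = (i : ℕ) ∧ F.a i = F.a j + 1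

/-- A two-cars parking function of size `m+n` with `n` labels equal to `1`, `m` labels
equal to `2`, and `k` decorated rises. -/
structure DecTwoCarsPF (m n k : ℕ) where
  pf : TwoCarsPF (m + n)
  ones_count : (univ.filter fun i => pf.l i = 1).card = n
  twos_count : (univ.filter fun i => pf.l i = 2).card = m
  marks : Finset (Fin (m + n))
  marks_card : marks.card = k
  marks_rise : ∀ i ∈ marks, IsPFRise pf i

/-- `underlined-area` of a decorated parking function: the sum of the area word entries
over the non-marked indices. -/
def pfUArea {m n k : ℕ} (F : DecTwoCarsPF m n k) : ℕ :=
  ∑ i ∈ univ \ F.marks, F.pf.a i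

/-- The number of labels equal to `2` lying on the main diagonal. -/
def diagTwos {N : ℕ} (F : TwoCarsPF N) : ℕ :=
  (univ.filter fun i => F.a i = 0 ∧ F.l i = 2).card

/-- `Tqt★(a,b;s;k)`: the `(dinv, underlined-area)` `q,t`-enumerator of two-cars parking
functions of size `a+b` with `b` labels equal to `1`, `a` labels equal to `2`, exactly
`s-1` labels equal to `2` on the main diagonal, and `k` decorated rises. -/
noncomputable def Tstar (a b s k : ℕ) : MvPolynomial (Fin 2) ℤ :=
  ∑ᶠ F : DecTwoCarsPF a b k,
    if diagTwos F.pf + 1 = s then Xq ^ pfDinv F.pf * Xt ^ pfUArea F else 0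

/- ## Partially labelled Dyck paths (all rises decorated, all valleys blank) -/

/-- A valley of a Dyck path (in terms of its area word): a north step preceded by an
east step. -/
def IsValleyW {N : ℕ} (a : Fin N → ℕ) (i : Fin N) : Prop :=
  ∃ j : Fin N, (j : ℕ) + 1 = (i : ℕ) ∧ a i ≤ a j

/-- A rise of a Dyck path (in terms of its area word): a north step preceded by a north
step. -/
def IsRiseW {N : ℕ} (a : Fin N → ℕ) (i : Fin N) : Prop :=
  ∃ j : Fin N, (j : ℕ) + 1 = (i : ℕ) ∧ a i = a j + 1

instance {N : ℕ} (a : Fin N → ℕ) : DecidablePred (IsValleyW a) := fun i =>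
  inferInstanceAs (Decidable (∃ j : Fin N, (j : ℕ) + 1 = (i : ℕ) ∧ a i ≤ a j))

instance {N : ℕ} (a : Fin N → ℕ) : DecidablePred (IsRiseW a) := fun i =>
  inferInstanceAs (Decidable (∃ j : Fin N, (j : ℕ) + 1 = (i : ℕ) ∧ a i = a j + 1))

/-- An element of `PLDP(m,n)^{★n}`: a partially labelled Dyck path of size `m+n+1`
(encoded by the area word `a` of the Dyck path and the labels `l` of its north steps,
with `0` denoting a blank) with `n+1` positive labels and `m` blanks, in which every
valley is a blank, every blank is a valley, labels strictly increase bottom to top in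
each column, and every rise is decorated. -/
structure PLDPall (m n : ℕ) where
  a : Fin (m + n + 1) → ℕ
  l : Fin (m + n + 1) → ℕ
  a_first : ∀ i : Fin (m + n + 1), (i : ℕ) = 0 → a i = 0
  a_step : ∀ i j : Fin (m + n + 1), (i : ℕ) + 1 = (j : ℕ) → a j ≤ a i + 1
  col_incr : ∀ i j : Fin (m + n + 1), (i : ℕ) + 1 = (j : ℕ) → a j = a i + 1 → l i < l j
  blank_iff_valley : ∀ i, l i = 0 ↔ IsValleyW a i
  blank_count : (univ.filter fun i => l i = 0).card = m

/-- `underlined-area` of an element of `PLDP(m,n)^{★n}`: the sum of the area word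
entries over the north steps that are not (decorated) rises. -/
def pldpUArea {m n : ℕ} (D : PLDPall m n) : ℕ :=
  ∑ i ∈ univ.filter (fun i => ¬ IsRiseW D.a i), D.a i

/-- A labelled reduced polyomino of size `m × n`: an `m × n` reduced parallelogram
polyomino together with `n+1` positive integer labels, one below the first column
(index `0`) and one on each north step of the red path (the north step with `j` north
steps before it getting the label of index `j+1`), such that labels strictly increase
bottom to top within each column (the label below the first column being treated as an
artificial north step at the very beginning of the red path). -/
structure LabelledRP (m n : ℕ) where
  poly : RedPoly m n
  lab : Fin (n + 1) → ℕ
  lab_pos : ∀ j, 1 ≤ lab j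
  col_incr : ∀ p : Fin (m + n), poly.red p = true →
    ((p : ℕ) = 0 ∨ ∃ q : Fin (m + n), (q : ℕ) + 1 = (p : ℕ) ∧ poly.red q = true) →
    ∀ h : truesBefore poly.red p + 1 < n + 1,
      lab ⟨truesBefore poly.red p, Nat.lt_of_succ_lt h⟩ <
      lab ⟨truesBefore poly.red p + 1, h⟩

/-- The path starting at height `h` and described by `l` stays weakly above the axis and ends
on it. -/
def IsPathFrom : ℕ → List Bool → Prop
  | h, [] => h = 0
  | h, true :: l => IsPathFrom (h + 1) l
  | h, false :: l => 0 < h ∧ IsPathFrom (h - 1) l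

/-- Alternation of the entries of `r` with the negated entries of `g`. -/
def interleave {N : ℕ} (r g : Fin N → Bool) : List Bool :=
  (List.ofFn fun i => [r i, !g i]).flatten

/-- Number of `true` values of `p` among its first `i` entries. -/
def prefixTrues {N : ℕ} (p : Fin N → Bool) (i : ℕ) : ℕ :=
  (univ.filter fun j : Fin N => (j : ℕ) < i ∧ p j = true).card

/-- The path starting at height `h` whose successive northeast steps start at the heights
listed in the given word, completed by southeast steps down to the axis. -/
def pathOfWord : ℕ → List ℕ → List Bool
  | h, [] => List.replicate h false
  | h, c :: w => List.replicate (h - c) false ++ true :: pathOfWord (c + 1) w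

theorem interleave_succ {N : ℕ} (r g : Fin (N + 1) → Bool) :
    interleave r g = r 0 :: (!g 0) :: interleave (fun i => r i.succ) (fun i => g i.succ) := by
  simp [interleave, List.ofFn_succ]

theorem interleave_zero (r g : Fin 0 → Bool) : interleave r g = [] := by
  simp [interleave]

theorem prefixTrues_zero {N : ℕ} (p : Fin N → Bool) : prefixTrues p 0 = 0 := by
  simp [prefixTrues]

theorem prefixTrues_of_isEmpty (p : Fin 0 → Bool) (i : ℕ) : prefixTrues p i = 0 := by
  simp [prefixTrues]

theorem prefixTrues_succ {N : ℕ} (p : Fin (N + 1) → Bool) (i : ℕ) :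
    prefixTrues p (i + 1) = (p 0).toNat + prefixTrues (fun j => p j.succ) i := by
  unfold prefixTrues
  rw [Fin.card_filter_univ_succ]
  cases h : p 0 <;> simp [Nat.add_comm]

theorem prefixTrues_self {N : ℕ} (p : Fin N → Bool) :
    prefixTrues p N = (univ.filter fun i => p i = true).card := by
  simp [prefixTrues]

theorem prefixTrues_val_succ {N : ℕ} (p : Fin N → Bool) (i : Fin N) :
    prefixTrues p (i + 1) = (univ.filter fun j => j ≤ i ∧ p j = true).card := by
  simp only [prefixTrues, Nat.lt_succ_iff, Fin.le_def]

theorem isPathFrom_interleave_iff {N : ℕ} (r g : Fin N → Bool) (k : ℕ) :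
    IsPathFrom (2 * k + 1) (interleave r g ++ [false]) ↔
      (∀ i ≤ N, prefixTrues g i ≤ k + prefixTrues r i) ∧
        prefixTrues g N = k + prefixTrues r N := by
  induction N generalizing k with
  | zero => simp [interleave_zero, IsPathFrom, prefixTrues_of_isEmpty, eq_comm]
  | succ N ih =>
    have shift : (∀ i ≤ N + 1, prefixTrues g i ≤ k + prefixTrues r i) ↔
        ∀ i ≤ N, (g 0).toNat + prefixTrues (fun j => g j.succ) i ≤
          k + ((r 0).toNat + prefixTrues (fun j => r j.succ) i) := by
      refine ⟨fun h i hi => ?_, fun h i hi => ?_⟩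
      · simpa only [prefixTrues_succ] using h (i + 1) (by omega)
      · cases i with
        | zero => simp [prefixTrues_zero]
        | succ i => simpa only [prefixTrues_succ] using h i (by omega)
    rw [shift, interleave_succ, prefixTrues_succ, prefixTrues_succ]
    cases hr : r 0 <;> cases hg : g 0 <;>
      simp only [List.cons_append, IsPathFrom, Bool.not_true, Bool.not_false, Bool.toNat_true,
        Bool.toNat_false, Nat.add_sub_cancel, Nat.zero_add, Nat.succ_pos, true_and]
    · rw [ih]
    · cases k with
      | zero =>
        simp only [Nat.mul_zero, lt_irrefl, false_and, false_iff, not_and]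
        intro h
        have := h 0 (Nat.zero_le _)
        simp [prefixTrues_zero] at this
      | succ k =>
        rw [show 2 * (k + 1) - 1 = 2 * k + 1 by omega, ih]
        simp only [show 0 < 2 * (k + 1) by omega, true_and]
        refine and_congr (forall₂_congr fun i _ => ?_) ?_ <;> omega
    · rw [show 2 * k + 1 + 1 + 1 = 2 * (k + 1) + 1 by omega, ih]
      simp only [Nat.add_assoc]
    · rw [ih]
      refine and_congr (forall₂_congr fun i _ => ?_) ?_ <;> omega

theorem isPathFrom_interlaced {m n : ℕ} (P : RedPoly m n) : IsPathFrom 0 (interlaced P) := by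
  refine (isPathFrom_interleave_iff P.red P.green 0).2 ⟨fun i hi => ?_, ?_⟩
  · cases i with
    | zero => simp [prefixTrues_zero]
    | succ i =>
      simpa only [prefixTrues_val_succ P.red ⟨i, hi⟩, prefixTrues_val_succ P.green ⟨i, hi⟩,
        Nat.zero_add] using P.green_le_red ⟨i, hi⟩
  · rw [prefixTrues_self, prefixTrues_self, P.red_count, P.green_count, Nat.zero_add]

theorem areaWordAux_interleave_length {N : ℕ} (r g : Fin N → Bool) (h : ℕ) :
    (areaWordAux h (interleave r g ++ [false])).length + prefixTrues g N =
      prefixTrues r N + N := by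
  induction N generalizing h with
  | zero => simp [interleave_zero, areaWordAux, prefixTrues_of_isEmpty]
  | succ N ih =>
    rw [interleave_succ, prefixTrues_succ, prefixTrues_succ]
    cases hr : r 0 <;> cases hg : g 0 <;>
      simp only [List.cons_append, areaWordAux, Bool.not_true, Bool.not_false, Bool.toNat_true,
        Bool.toNat_false, List.length_cons]
    · have := ih (fun i => r i.succ) (fun i => g i.succ) (h - 1 + 1); omega
    · have := ih (fun i => r i.succ) (fun i => g i.succ) (h - 1 - 1); omega
    · have := ih (fun i => r i.succ) (fun i => g i.succ) (h + 1 + 1); omega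
    · have := ih (fun i => r i.succ) (fun i => g i.succ) (h + 1 - 1); omega

theorem areaWordAux_interleave_barred {N : ℕ} (r g : Fin N → Bool) (k : ℕ)
    (hp : IsPathFrom (2 * k + 1) (interleave r g ++ [false])) :
    ((areaWordAux (2 * k + 1) (interleave r g ++ [false])).filter fun c => c % 2 = 1).length =
      prefixTrues r N := by
  induction N generalizing k with
  | zero => simp [interleave_zero, areaWordAux, prefixTrues_of_isEmpty]
  | succ N ih =>
    rw [interleave_succ] at hp ⊢
    rw [prefixTrues_succ]
    cases hr : r 0 <;> cases hg : g 0 <;>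
      simp only [hr, hg, List.cons_append, areaWordAux, IsPathFrom, Bool.not_true, Bool.not_false,
        Bool.toNat_true, Bool.toNat_false, Nat.add_sub_cancel] at hp ⊢
    · simp [ih _ _ k hp.2]
    · obtain ⟨k, rfl⟩ : ∃ j, k = j + 1 := ⟨k - 1, by omega⟩
      rw [show 2 * (k + 1) - 1 = 2 * k + 1 by omega] at hp ⊢
      simp [ih _ _ k hp.2.2]
    · rw [show 2 * k + 1 + 1 + 1 = 2 * (k + 1) + 1 by omega] at hp ⊢
      rw [List.filter_cons_of_pos (by simp), List.length_cons,
        List.filter_cons_of_neg (by simp [Nat.add_mod]), ih _ _ (k + 1) hp, Nat.add_comm]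
    · rw [List.filter_cons_of_pos (by simp), List.length_cons, ih _ _ k hp.2, Nat.add_comm]

theorem isChain_cons_areaWordAux (l : List Bool) (c h : ℕ) (hc : h ≤ c + 1) :
    (c :: areaWordAux h l).IsChain (fun a b => b ≤ a + 1) := by
  induction l generalizing c h with
  | nil => simp [areaWordAux]
  | cons b l ih =>
    cases b with
    | false => exact ih c (h - 1) (by omega)
    | true => exact List.isChain_cons_cons.2 ⟨hc, ih h (h + 1) le_rfl⟩

theorem isChain_iff_getD_succ_le (w : List ℕ) :
    w.IsChain (fun a b => b ≤ a + 1) ↔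
      ∀ i, i + 1 < w.length → w.getD (i + 1) 0 ≤ w.getD i 0 + 1 := by
  rw [List.isChain_iff_getElem]
  refine forall₂_congr fun i hi => ?_
  rw [List.getD_eq_getElem _ _ hi, List.getD_eq_getElem _ _ (by omega)]

theorem le_of_mem_head?_areaWordAux (l : List Bool) (h c : ℕ)
    (hc : c ∈ (areaWordAux h l).head?) : c ≤ h := by
  induction l generalizing h with
  | nil => simp [areaWordAux] at hc
  | cons b l ih =>
    cases b with
    | false => exact (ih (h - 1) hc).trans (Nat.sub_le _ _)
    | true => simp [areaWordAux] at hc; exact hc.ge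

theorem areaWordAux_injective {h : ℕ} {l l' : List Bool} (hl : IsPathFrom h l)
    (hl' : IsPathFrom h l') (heq : areaWordAux h l = areaWordAux h l') : l = l' := by
  have disjoint : ∀ {h : ℕ} {l l' : List Bool}, 0 < h →
      areaWordAux h (true :: l) ≠ areaWordAux h (false :: l') := by
    intro h l l' hpos heq
    have := le_of_mem_head?_areaWordAux l' (h - 1) h (by
      change h ∈ (areaWordAux h (false :: l')).head?
      rw [← heq]
      rfl)
    omega
  induction l generalizing h l' with
  | nil =>
    obtain rfl : h = 0 := hl
    match l', hl', heq with
    | [], _, _ => rfl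
    | true :: _, _, heq => simp [areaWordAux] at heq
    | false :: _, hl', _ => exact absurd hl'.1 (lt_irrefl _)
  | cons b l ih =>
    match b, l', hl, hl', heq with
    | true, [], _, _, heq => simp [areaWordAux] at heq
    | false, [], hl, hl', _ =>
      obtain rfl : h = 0 := hl'
      exact absurd hl.1 (lt_irrefl _)
    | true, true :: _, hl, hl', heq => rw [ih hl hl' (List.cons.inj heq).2]
    | false, false :: _, hl, hl', heq => rw [ih hl.2 hl'.2 heq]
    | true, false :: _, _, hl', heq => exact absurd heq (disjoint hl'.1)
    | false, true :: _, hl, _, heq => exact absurd heq.symm (disjoint hl.1)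

theorem interleave_injective {N : ℕ} {r g r' g' : Fin N → Bool}
    (h : interleave r g = interleave r' g') : r = r' ∧ g = g' := by
  induction N with
  | zero => exact ⟨Subsingleton.elim _ _, Subsingleton.elim _ _⟩
  | succ N ih =>
    simp only [interleave_succ, List.cons.injEq, Bool.not_inj_iff] at h
    obtain ⟨hr, hg⟩ := ih h.2.2
    exact ⟨funext (Fin.cases h.1 (congrFun hr)), funext (Fin.cases h.2.1 (congrFun hg))⟩

theorem exists_interleave_eq {N : ℕ} {l : List Bool} (hl : l.length = 2 * N) :
    ∃ r g : Fin N → Bool, interleave r g = l := by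
  induction N generalizing l with
  | zero =>
    obtain rfl : l = [] := List.length_eq_zero_iff.1 hl
    exact ⟨Fin.elim0, Fin.elim0, interleave_zero _ _⟩
  | succ N ih =>
    match l, hl with
    | a :: b :: l, hl =>
      obtain ⟨r, g, rfl⟩ := ih (l := l) (by simp at hl; omega)
      exact ⟨Fin.cons a r, Fin.cons (!b) g, by simp [interleave_succ]⟩

theorem isPathFrom_replicate_append (d h : ℕ) (l : List Bool) (hl : IsPathFrom h l) :
    IsPathFrom (h + d) (List.replicate d false ++ l) := by
  induction d with
  | zero => exact hl
  | succ d ih => exact ⟨by omega, ih⟩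

theorem areaWordAux_replicate_append (d h : ℕ) (l : List Bool) :
    areaWordAux h (List.replicate d false ++ l) = areaWordAux (h - d) l := by
  induction d generalizing h with
  | zero => rfl
  | succ d ih =>
    rw [Nat.add_comm, ← Nat.sub_sub, ← ih, Nat.add_comm]
    rfl

theorem pathOfWord_spec (w : List ℕ) (c : ℕ) (hw : (c :: w).IsChain fun a b => b ≤ a + 1) :
    IsPathFrom (c + 1) (pathOfWord (c + 1) w) ∧
      areaWordAux (c + 1) (pathOfWord (c + 1) w) = w ∧
      (pathOfWord (c + 1) w).length = c + 1 + 2 * w.length := by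
  induction w generalizing c with
  | nil =>
    refine ⟨?_, ?_, by simp [pathOfWord]⟩
    · simpa [pathOfWord] using isPathFrom_replicate_append (c + 1) 0 [] rfl
    · simpa [pathOfWord, areaWordAux] using areaWordAux_replicate_append (c + 1) (c + 1) []
  | cons d w ih =>
    obtain ⟨hd, hw⟩ := List.isChain_cons_cons.1 hw
    obtain ⟨h₁, h₂, h₃⟩ := ih d hw
    refine ⟨?_, ?_, ?_⟩
    · have := isPathFrom_replicate_append (c + 1 - d) d (true :: pathOfWord (d + 1) w) h₁
      rwa [Nat.add_sub_cancel' hd] at this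
    · rw [pathOfWord, areaWordAux_replicate_append, Nat.sub_sub_self hd, areaWordAux, h₂]
    · simp only [pathOfWord, List.length_append, List.length_replicate, List.length_cons, h₃]
      omega

theorem IsPathFrom.exists_eq_append {h : ℕ} {l : List Bool} (hl : IsPathFrom h l) (hne : l ≠ []) :
    ∃ l', l = l' ++ [false] := by
  induction l generalizing h with
  | nil => exact absurd rfl hne
  | cons b l ih =>
    cases l with
    | nil =>
      cases b with
      | false => exact ⟨[], rfl⟩
      | true => exact absurd hl (Nat.succ_ne_zero h)
    | cons a l =>
      obtain ⟨h', hl'⟩ : ∃ h', IsPathFrom h' (a :: l) := by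
        cases b with
        | false => exact ⟨_, hl.2⟩
        | true => exact ⟨_, hl⟩
      obtain ⟨l', hl'⟩ := ih hl' (List.cons_ne_nil _ _)
      exact ⟨b :: l', by rw [hl', List.cons_append]⟩

theorem areaWord_eq_cons {m n : ℕ} (P : RedPoly m n) :
    areaWord P = 0 :: areaWordAux 1 (interleave P.red P.green ++ [false]) := rfl

theorem areaWord_injective {m n : ℕ} : Function.Injective (areaWord (m := m) (n := n)) := by
  intro P Q h
  have hD := areaWordAux_injective (isPathFrom_interlaced P) (isPathFrom_interlaced Q) h
  obtain ⟨hr, hg⟩ := interleave_injective (List.append_cancel_right (List.cons.inj hD).2)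
  cases P
  cases Q
  cases hr
  cases hg
  rfl

theorem length_filter_even_add_odd (w : List ℕ) :
    (w.filter fun c => c % 2 = 0).length + (w.filter fun c => c % 2 = 1).length = w.length := by
  induction w with
  | nil => rfl
  | cons c w ih => rcases Nat.mod_two_eq_zero_or_one c with h | h <;> simp [h] <;> omega

theorem length_areaWord {m n : ℕ} (P : RedPoly m n) : (areaWord P).length = m + n + 1 := by
  have := areaWordAux_interleave_length P.red P.green 1
  rw [prefixTrues_self, prefixTrues_self, P.red_count, P.green_count] at this
  rw [areaWord_eq_cons, List.length_cons]
  omega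

theorem length_filter_barred_areaWord {m n : ℕ} (P : RedPoly m n) :
    ((areaWord P).filter fun c => c % 2 = 1).length = n := by
  have := areaWordAux_interleave_barred P.red P.green 0 (isPathFrom_interlaced P)
  rw [prefixTrues_self, P.red_count] at this
  rw [areaWord_eq_cons, List.filter_cons_of_neg (by simp)]
  exact this

theorem exists_areaWord_eq {m n : ℕ} {w : List ℕ} (hlen : (0 :: w).length = m + n + 1)
    (hw : (0 :: w).IsChain fun a b => b ≤ a + 1)
    (hodd : ((0 :: w).filter fun c => c % 2 = 1).length = n) :
    ∃ P : RedPoly m n, areaWord P = 0 :: w := by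
  obtain ⟨hpath, hword, hl⟩ := pathOfWord_spec w 0 hw
  obtain ⟨l, hl'⟩ := hpath.exists_eq_append (by rintro h; simp [h] at hl; omega)
  rw [hl'] at hpath hword hl
  simp only [List.length_append, List.length_cons, List.length_nil] at hl hlen
  obtain ⟨r, g, rfl⟩ := exists_interleave_eq (N := m + n) (l := l) (by omega)
  have hr := areaWordAux_interleave_barred r g 0 hpath
  obtain ⟨hle, hg⟩ := (isPathFrom_interleave_iff r g 0).1 hpath
  rw [List.filter_cons_of_neg (by simp)] at hodd
  have hrn : prefixTrues r (m + n) = n := by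
    exact hr.symm.trans
      ((congrArg (fun v : List ℕ => (v.filter fun c => c % 2 = 1).length) hword).trans hodd)
  refine ⟨⟨r, g, ?_, ?_, fun i => ?_⟩, congrArg (List.cons 0) hword⟩
  · rw [← prefixTrues_self, hrn]
  · rw [← prefixTrues_self, hg, hrn, Nat.zero_add]
  · simpa only [← prefixTrues_val_succ, Nat.zero_add] using hle (i + 1) i.2

theorem stmt0 (m n : ℕ) (hm : 1 ≤ m) (hn : 1 ≤ n) :
    Set.BijOn (fun P : RedPoly m n => areaWord P) Set.univ
      {w : List ℕ | w.length = m + n + 1 ∧ w.head? = some 0 ∧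
        (∀ i, i + 1 < w.length → w.getD (i + 1) 0 ≤ w.getD i 0 + 1) ∧
        (w.filter fun c => c % 2 = 0).length = m + 1 ∧
        (w.filter fun c => c % 2 = 1).length = n} := by
  refine ⟨fun P _ => ⟨length_areaWord P, rfl, ?_, ?_, length_filter_barred_areaWord P⟩,
    areaWord_injective.injOn, ?_⟩
  · exact (isChain_iff_getD_succ_le _).1 (isChain_cons_areaWordAux _ 0 1 le_rfl)
  · have h₁ := length_filter_even_add_odd (areaWord P)
    have h₂ := length_areaWord P
    have h₃ := length_filter_barred_areaWord P
    dsimp only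
    omega
  · rintro w ⟨hlen, hhead, hchain, -, hodd⟩
    obtain ⟨w, rfl⟩ := List.head?_eq_some_iff.1 hhead
    obtain ⟨P, hP⟩ := exists_areaWord_eq hlen ((isChain_iff_getD_succ_le _).2 hchain) hodd
    exact ⟨P, trivial, hP⟩
end

section
/- For every reduced parallelogram polyomino P of size m×n (m, n ≥ 1), area(P), defined as the sum of the numeric values of the letters of the area word of P, equals the number of unit lattice squares lying between the green path and the red path of P (i.e., weakly above the green path and weakly below the red path). -/
open Finset

/-- Number of `true` entries of `p` among the positions `0, …, i - 1`. -/
def prefixCount {N : ℕ} (p : Fin N → Bool) (i : ℕ) : ℕ :=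
  (univ.filter fun l : Fin N => (l : ℕ) < i ∧ p l = true).card

theorem prefixCount_zero {N : ℕ} (p : Fin N → Bool) : prefixCount p 0 = 0 := by
  simp [prefixCount]

theorem prefixCount_self {N : ℕ} (p : Fin N → Bool) :
    prefixCount p N = (univ.filter fun i => p i = true).card := by
  simp [prefixCount]

theorem prefixCount_succ {N : ℕ} (p : Fin N → Bool) (j : Fin N) :
    prefixCount p (j + 1) = prefixCount p j + (p j).toNat := by
  unfold prefixCount
  cases h : p j
  · simp only [Bool.toNat_false, add_zero]
    congr 1
    ext l
    simp only [mem_filter, mem_univ, true_and]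
    refine ⟨fun ⟨h1, h2⟩ => ⟨?_, h2⟩, fun ⟨h1, h2⟩ => ⟨by omega, h2⟩⟩
    rcases Nat.lt_succ_iff_lt_or_eq.1 h1 with h3 | h3
    · exact h3
    · rw [Fin.ext h3, h] at h2
      cases h2
  · rw [Bool.toNat_true, ← card_insert_of_notMem (a := j) (by simp)]
    congr 1
    ext l
    simp only [mem_insert, mem_filter, mem_univ, true_and, Fin.ext_iff]
    constructor
    · rintro ⟨h1, h2⟩
      by_cases h3 : (l : ℕ) = j
      · exact Or.inl h3
      · exact Or.inr ⟨by omega, h2⟩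
    · rintro (h1 | ⟨h1, h2⟩)
      · exact ⟨by omega, by rw [Fin.ext h1, h]⟩
      · exact ⟨by omega, h2⟩

theorem falsesBefore_add_prefixCount {N : ℕ} (p : Fin N → Bool) (j : Fin N) :
    falsesBefore p j + prefixCount p j = j := by
  have h := card_filter_add_card_filter_not (s := univ.filter fun l : Fin N => l < j)
    (fun l => p l = true)
  rw [filter_filter, filter_filter, filter_gt_eq_Iio, Fin.card_Iio] at h
  simp only [Bool.not_eq_true] at h
  rw [add_comm]
  exact h

theorem prefixCount_mono {N : ℕ} (p : Fin N → Bool) : Monotone (prefixCount p) := by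
  intro a b hab
  refine card_le_card fun l => ?_
  simp only [mem_filter, mem_univ, true_and]
  exact fun ⟨h1, h2⟩ => ⟨h1.trans_le hab, h2⟩

theorem falsesBefore_mono {N : ℕ} (p : Fin N → Bool) : Monotone (falsesBefore p) := by
  intro a b hab
  refine card_le_card fun l => ?_
  simp only [mem_filter, mem_univ, true_and]
  exact fun ⟨h1, h2⟩ => ⟨h1.trans_le hab, h2⟩

theorem falsesBefore_add_count_le {N : ℕ} (p : Fin N → Bool) (j : Fin N) :
    falsesBefore p j + (univ.filter fun i => p i = true).card ≤ N := by
  have h := card_filter_add_card_filter_not (s := (univ : Finset (Fin N)))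
    (fun l => p l = true)
  simp only [Bool.not_eq_true, card_univ, Fintype.card_fin] at h
  have h' : falsesBefore p j ≤ (univ.filter fun i => p i = false).card :=
    card_le_card fun l => by simp
  omega

/-- The height over a column is monotone with respect to the order of lattice paths. -/
theorem heightAt_le_heightAt {N : ℕ} {p q : Fin N → Bool}
    (h : ∀ i : Fin N, prefixCount p (i + 1) ≤ prefixCount q (i + 1)) (x : ℕ) :
    heightAt p x ≤ heightAt q x := by
  unfold heightAt
  rcases (univ.filter fun j => p j = true ∧ falsesBefore p j ≤ x).eq_empty_or_nonempty
    with he | hne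
  · simp [he]
  · obtain ⟨j, hj, hmax⟩ := exists_max_image _ id hne
    simp only [mem_filter, mem_univ, true_and, id] at hj hmax
    calc _ ≤ prefixCount p (j + 1) := card_le_card fun l hl => by
            simp only [mem_filter, mem_univ, true_and] at hl ⊢
            exact ⟨Nat.lt_succ_of_le (hmax l hl), hl.1⟩
      _ ≤ prefixCount q (j + 1) := h j
      _ ≤ _ := card_le_card fun l hl => by
            simp only [mem_filter, mem_univ, true_and] at hl ⊢
            refine ⟨hl.2, ?_⟩
            have hlj : l ≤ j := Nat.le_of_lt_succ hl.1
            have h1 := falsesBefore_add_prefixCount p j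
            have h2 := falsesBefore_add_prefixCount q j
            have h3 := prefixCount_succ p j
            have h4 := prefixCount_succ q j
            have h5 := h j
            rw [hj.1, Bool.toNat_true] at h3
            rcases hlj.eq_or_lt with rfl | hlt
            · rw [hl.2, Bool.toNat_true] at h4
              omega
            · have h6 := falsesBefore_mono q hlj
              have h7 := falsesBefore_add_prefixCount q l
              have h8 := prefixCount_succ q l
              have h9 := prefixCount_mono q (show (l : ℕ) + 1 ≤ j from hlt)
              cases hq : q j
              · rw [hq, Bool.toNat_false] at h4
                omega
              · rw [hq, Bool.toNat_true] at h4
                omega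

theorem sum_heightAt {N : ℕ} (p : Fin N → Bool) (m : ℕ) :
    ∑ x ∈ range m, heightAt p x =
      ∑ j : Fin N, if p j = true then m - falsesBefore p j else 0 := by
  simp only [heightAt, card_filter]
  rw [sum_comm]
  refine sum_congr rfl fun j _ => ?_
  split_ifs with hj
  · simp only [hj, true_and]
    rw [← card_filter, ← Nat.card_Ico]
    congr 1
    ext x
    simp only [mem_filter, mem_range, mem_Ico]
    exact and_comm
  · simp [hj]

/-- The sum of the values of the letters of an interlaced path, where `A` and `B` record
the heights of the two paths. -/
theorem sum_areaWordAux_interlaced {N : ℕ} (r g : Fin N → Bool) (A B : ℕ → ℕ)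
    (hA : ∀ i : Fin N, A (i + 1) = A i + (r i).toNat)
    (hB : ∀ i : Fin N, B (i + 1) = B i + (g i).toNat)
    (hBA : ∀ i ≤ N, B i ≤ A i) :
    ((areaWordAux (1 + 2 * (A 0 - B 0))
      ((List.ofFn fun i => [r i, !g i]).flatten ++ [false])).map fun c => c / 2).sum =
      ∑ i : Fin N, ((if r i = true then A i - B i else 0) +
        if g i = true then 0 else A (i + 1) - B (i + 1)) := by
  induction N generalizing A B with
  | zero => simp [areaWordAux]
  | succ N ih =>
    have key := ih (fun i => r i.succ) (fun i => g i.succ) (fun i => A (i + 1))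
      (fun i => B (i + 1)) (fun i => hA i.succ) (fun i => hB i.succ)
      (fun i hi => hBA (i + 1) (by omega))
    have a0 := hA 0
    have b0 := hB 0
    have c0 := hBA 0 (by omega)
    have c1 := hBA 1 (by omega)
    rw [Fin.sum_univ_succ, List.ofFn_succ]
    simp only [Fin.val_succ, Fin.val_zero, zero_add] at key a0 b0 ⊢
    rw [← key]
    simp only [List.flatten_cons, List.cons_append, List.nil_append]
    cases hr : r 0 <;> cases hg : g 0 <;>
      simp only [hr, hg, Bool.toNat_true, Bool.toNat_false, Bool.not_true, Bool.not_false,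
        areaWordAux, List.map_cons, List.sum_cons, if_true, Bool.false_eq_true, if_false]
        at a0 b0 ⊢
    · rw [show 1 + 2 * (A 0 - B 0) - 1 + 1 = 1 + 2 * (A 1 - B 1) by omega]
      omega
    · rw [show 1 + 2 * (A 0 - B 0) - 1 - 1 = 1 + 2 * (A 1 - B 1) by omega]
      omega
    · rw [show 1 + 2 * (A 0 - B 0) + 1 + 1 = 1 + 2 * (A 1 - B 1) by omega]
      omega
    · rw [show 1 + 2 * (A 0 - B 0) + 1 - 1 = 1 + 2 * (A 1 - B 1) by omega]
      omega

theorem card_cells_between (m n : ℕ) (a b : ℕ → ℕ) (hb : ∀ x, b x ≤ n) :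
    ((range m ×ˢ range n).filter fun c => a c.1 ≤ c.2 ∧ c.2 < b c.1).card =
      ∑ x ∈ range m, (b x - a x) := by
  rw [card_filter, sum_product]
  refine sum_congr rfl fun x _ => ?_
  rw [← card_filter, ← Nat.card_Ico]
  congr 1
  ext y
  simp only [mem_filter, mem_range, mem_Ico]
  have := hb x
  omega

namespace RedPoly

variable {m n : ℕ} (P : RedPoly m n)

theorem prefixCount_green_le_red (i : Fin (m + n)) :
    prefixCount P.green (i + 1) ≤ prefixCount P.red (i + 1) := by
  simpa only [prefixCount, Nat.lt_succ_iff, Fin.le_def] using P.green_le_red i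

theorem prefixCount_green_le_red_of_le (i : ℕ) (hi : i ≤ m + n) :
    prefixCount P.green i ≤ prefixCount P.red i := by
  cases i with
  | zero => simp [prefixCount_zero]
  | succ i => exact P.prefixCount_green_le_red ⟨i, hi⟩

theorem areaStat_eq_sum :
    areaStat P = ∑ i : Fin (m + n),
      ((if P.red i = true then prefixCount P.red i - prefixCount P.green i else 0) +
        if P.green i = true then 0
        else prefixCount P.red (i + 1) - prefixCount P.green (i + 1)) := by
  rw [← sum_areaWordAux_interlaced P.red P.green _ _ (prefixCount_succ _)
    (prefixCount_succ _) P.prefixCount_green_le_red_of_le]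
  simp [areaStat, areaWord, interlaced, areaWordAux, prefixCount_zero]

theorem cast_sum_heightAt (p : Fin (m + n) → Bool)
    (hp : (univ.filter fun i => p i = true).card = n) :
    ((∑ x ∈ range m, heightAt p x : ℕ) : ℤ) =
      ∑ j : Fin (m + n), ((p j).toNat : ℤ) * (m - j + prefixCount p j) := by
  rw [sum_heightAt, Nat.cast_sum]
  refine sum_congr rfl fun j _ => ?_
  have h1 := falsesBefore_add_prefixCount p j
  have h2 := falsesBefore_add_count_le p j
  cases hj : p j <;> simp
  omega

end RedPoly

theorem stmt1 (m n : ℕ) (hm : 1 ≤ m) (hn : 1 ≤ n) (P : RedPoly m n) :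
    areaStat P =
      ((Finset.range m ×ˢ Finset.range n).filter fun c =>
        heightAt P.green c.1 ≤ c.2 ∧ c.2 < heightAt P.red c.1).card := by
  have hle := heightAt_le_heightAt P.prefixCount_green_le_red
  have hred : ∀ x, heightAt P.red x ≤ n := fun x =>
    (card_le_card fun j => by simp +contextual).trans_eq P.red_count
  rw [card_cells_between m n _ _ hred, P.areaStat_eq_sum, sum_tsub_distrib _ fun x _ => hle x]
  zify [sum_le_sum fun x (_ : x ∈ range m) => hle x]
  rw [← Nat.cast_sum, ← Nat.cast_sum, RedPoly.cast_sum_heightAt _ P.red_count,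
    RedPoly.cast_sum_heightAt _ P.green_count, ← sub_eq_zero, ← sum_sub_distrib,
    ← sum_sub_distrib]
  let R : ℕ → ℤ := fun i => prefixCount P.red i
  let G : ℕ → ℤ := fun i => prefixCount P.green i
  let Φ : ℕ → ℤ := fun i => (m - i) * (G i - R i) + G i ^ 2 - R i * G i
  have hΦ : ∑ i : Fin (m + n), (Φ (i + 1) - Φ i) = 0 := by
    rw [Fin.sum_univ_eq_sum_range (fun i => Φ (i + 1) - Φ i), sum_range_sub]
    simp only [Φ, R, G, prefixCount_zero, prefixCount_self, P.red_count, P.green_count]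
    push_cast
    ring
  refine (sum_congr rfl fun i _ => ?_).trans hΦ
  have h0 := P.prefixCount_green_le_red_of_le i i.2.le
  have h1 := P.prefixCount_green_le_red i
  have hr := prefixCount_succ P.red i
  have hg := prefixCount_succ P.green i
  simp only [Φ, R, G]
  rw [Nat.cast_sub h0, Nat.cast_sub h1, hr, hg]
  cases P.red i <;> cases P.green i <;> simp <;> ring
end

section
/- For all m, n ≥ 1 and k ≥ 0 there exists a bijection ζ : RP(m,n)^{•k} → RP(n,m)^{★k} such that for every P ∈ RP(m,n)^{•k} one has dinv(ζ(P)) = area(P) and underlined-area(ζ(P)) = underlined-bounce(P); moreover the k decorated red valleys of P correspond to the k decorated rises of ζ(P), and if the bounce path of P carries exactly s−1 labels equal to the letter 0, then the area word of ζ(P) contains exactly s letters equal to the unbarred letter 0. -/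
open Finset

/- ## Decomposing words into levels -/

/-- The subword of `w` formed by the letters at most `l + 1`, with `true` standing for
`l + 1` and `false` for the other letters. -/
def levelPattern (l : ℕ) : List ℕ → List Bool
  | [] => []
  | x :: w => if x ≤ l + 1 then decide (x = l + 1) :: levelPattern l w else levelPattern l w

/-- The subword of the letters greater than `l`. -/
def lettersAbove (l : ℕ) (w : List ℕ) : List ℕ := w.filter fun x => l < x

/-- The patterns of the levels `l, l + 2, …` concatenated, together with the patterns of the
levels `l + 1, l + 3, …` concatenated; the first argument bounds the number of levels. -/
def levelPaths : ℕ → ℕ → List ℕ → List Bool × List Bool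
  | 0, _, _ => ([], [])
  | f + 1, l, w =>
    (levelPattern l w ++ (levelPaths f (l + 1) (lettersAbove l w)).2,
      (levelPaths f (l + 1) (lettersAbove l w)).1)

/-- Words with first letter `l`, all letters at least `l`, increasing by at most one at
each step. -/
structure IsLevelWord (l : ℕ) (w : List ℕ) : Prop where
  le : ∀ x ∈ w, l ≤ x
  chain : w.IsChain fun a b => b ≤ a + 1
  head : ∀ x ∈ w.head?, x = l

/-- The number of pairs of a `true` preceding a `false`. -/
def boolInv : List Bool → ℕ
  | [] => 0
  | true :: p => p.count false + boolInv p
  | false :: p => boolInv p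

/-- The number of pairs of a letter preceding its predecessor in the alphabet. -/
def wordInv : List ℕ → ℕ
  | [] => 0
  | x :: w => w.countP (fun y => x = y + 1) + wordInv w

/-- The number of `true` entries before the `(x+1)`-st `false` entry. -/
def truesUpTo : List Bool → ℕ → ℕ
  | [], _ => 0
  | true :: p, x => truesUpTo p x + 1
  | false :: _, 0 => 0
  | false :: p, x + 1 => truesUpTo p x

/-- The number of `true` entries having fewer than `t` entries `true` before them and
preceded by a `false`; the first argument tells whether a `false` precedes the list. -/
def valleysUpTo : Bool → List Bool → ℕ → ℕ
  | _, [], _ => 0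
  | _, true :: _, 0 => 0
  | b, true :: p, t + 1 => b.toNat + valleysUpTo false p t
  | _, false :: p, t => valleysUpTo true p t

/-- The number of consecutive pairs `x, x + 1` with `Q x` in `a :: w`. -/
def risesAux (Q : ℕ → Bool) : ℕ → List ℕ → ℕ
  | _, [] => 0
  | a, b :: w => (decide (b = a + 1) && Q a).toNat + risesAux Q b w

/-- The number of consecutive pairs `x, x + 1` with `Q x`. -/
def rises (Q : ℕ → Bool) : List ℕ → ℕ
  | [] => 0
  | a :: w => risesAux Q a w

theorem isChain_lettersAbove {l a : ℕ} {w : List ℕ} (ha : l ≤ a) (hw : ∀ x ∈ w, l ≤ x)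
    (h : (a :: w).IsChain fun a b => b ≤ a + 1) :
    (a :: lettersAbove l w).IsChain fun a b => b ≤ a + 1 := by
  induction w generalizing a with
  | nil => simp [lettersAbove]
  | cons b w ih =>
    rw [List.isChain_cons_cons] at h
    have hb : l ≤ b := hw b (by simp)
    have := ih hb (fun x hx => hw x (by simp [hx])) h.2
    unfold lettersAbove at this ⊢
    rw [List.filter_cons]
    split_ifs with hlb
    · exact List.isChain_cons_cons.2 ⟨h.1, this⟩
    · simp only [decide_eq_true_eq] at hlb
      obtain rfl : b = l := by omega
      rw [List.isChain_cons] at this ⊢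
      exact ⟨fun y hy => (this.1 y hy).trans (by omega), this.2⟩

theorem IsLevelWord.lettersAbove {l : ℕ} {w : List ℕ} (h : IsLevelWord l w) :
    IsLevelWord (l + 1) (lettersAbove l w) := by
  cases w with
  | nil => constructor <;> simp [_root_.lettersAbove]
  | cons a w =>
    obtain rfl : a = l := h.head a (by simp)
    have hc := isChain_lettersAbove le_rfl (fun x hx => h.le x (by simp [hx])) h.chain
    have e : _root_.lettersAbove a (a :: w) = _root_.lettersAbove a w := by
      simp [_root_.lettersAbove]
    have hle : ∀ x ∈ _root_.lettersAbove a w, a + 1 ≤ x := by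
      intro x hx
      simp only [_root_.lettersAbove, List.mem_filter, decide_eq_true_eq] at hx
      omega
    rw [e]
    rw [List.isChain_cons] at hc
    exact ⟨hle, hc.2, fun x hx =>
      le_antisymm (hc.1 x hx) (hle x (List.mem_of_mem_head? hx))⟩

theorem count_false_levelPattern {l : ℕ} {w : List ℕ} (hw : ∀ x ∈ w, l ≤ x) :
    (levelPattern l w).count false = w.count l := by
  induction w with
  | nil => rfl
  | cons x w ih =>
    have hx : l ≤ x := hw x (by simp)
    have := ih fun y hy => hw y (by simp [hy])
    grind [levelPattern]

theorem count_true_levelPattern {l : ℕ} {w : List ℕ} :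
    (levelPattern l w).count true = w.count (l + 1) := by
  induction w with
  | nil => rfl
  | cons x w ih => grind [levelPattern]

theorem count_lettersAbove {l a : ℕ} (h : l < a) (w : List ℕ) :
    (lettersAbove l w).count a = w.count a := by
  rw [lettersAbove, List.count_filter (by simpa using h)]

theorem levelPaths_nil (f l : ℕ) : levelPaths f l [] = ([], []) := by
  induction f generalizing l with
  | zero => rfl
  | succ f ih => simp [levelPaths, levelPattern, lettersAbove, ih]

theorem head?_levelPaths_fst {l : ℕ} {w : List ℕ} (f : ℕ) (h : IsLevelWord l w) :
    ∀ b ∈ (levelPaths f l w).1.head?, b = false := by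
  cases w with
  | nil => simp [levelPaths_nil]
  | cons a w =>
    obtain rfl : a = l := h.head a (by simp)
    cases f <;> simp [levelPaths, levelPattern]

theorem head?_levelPaths_snd {l : ℕ} {w : List ℕ} (f : ℕ) (h : IsLevelWord l w) :
    ∀ b ∈ (levelPaths f l w).2.head?, b = false := by
  cases f with
  | zero => simp [levelPaths]
  | succ f => exact head?_levelPaths_fst f h.lettersAbove

theorem eq_nil_of_bound {l : ℕ} {w : List ℕ} (h : ∀ x ∈ w, l ≤ x) (hb : ∀ x ∈ w, x < l + 0) :
    w = [] :=
  List.eq_nil_iff_forall_not_mem.2 fun x hx => by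
    have := h x hx
    have := hb x hx
    omega

theorem bound_lettersAbove {f l : ℕ} {w : List ℕ} (h : ∀ x ∈ w, x < l + (f + 1)) :
    ∀ x ∈ lettersAbove l w, x < l + 1 + f := fun x hx => by
  have := h x (List.mem_of_mem_filter hx)
  omega

theorem countP_lettersAbove {l : ℕ} {w : List ℕ} (hw : ∀ x ∈ w, l ≤ x) (Q : ℕ → Bool) :
    w.countP Q = (lettersAbove l w).countP Q + if Q l then w.count l else 0 := by
  induction w with
  | nil => simp [lettersAbove]
  | cons x w ih =>
    have hx : l ≤ x := hw x (by simp)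
    have := ih fun y hy => hw y (by simp [hy])
    grind [lettersAbove]

theorem count_levelPaths {f l : ℕ} {w : List ℕ} (h : IsLevelWord l w)
    (hb : ∀ x ∈ w, x < l + f) :
    (levelPaths f l w).1.count false = w.countP (fun x => x % 2 = l % 2) ∧
    (levelPaths f l w).1.count true = w.countP (fun x => x % 2 = (l + 1) % 2) ∧
    (levelPaths f l w).2.count false = w.countP (fun x => x % 2 = (l + 1) % 2) ∧
    (levelPaths f l w).2.count true + w.count l = w.countP (fun x => x % 2 = l % 2) := by
  induction f generalizing l w with
  | zero => obtain rfl := eq_nil_of_bound h.le hb; simp [levelPaths]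
  | succ f ih =>
    obtain ⟨h1, h2, h3, h4⟩ := ih h.lettersAbove (bound_lettersAbove hb)
    have e1 := countP_lettersAbove h.le (fun x => decide (x % 2 = l % 2))
    have e2 := countP_lettersAbove h.le (fun x => decide (x % 2 = (l + 1) % 2))
    have hl : (l + 1 + 1) % 2 = l % 2 := by omega
    have hl' : ¬ l % 2 = (l + 1) % 2 := by omega
    rw [hl] at h2 h3
    simp only [decide_true, if_true, hl', decide_false, Bool.false_eq_true, if_false] at e1 e2
    have c1 := count_lettersAbove (Nat.lt_succ_self l) w
    simp only [levelPaths, List.count_append, count_false_levelPattern h.le,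
      count_true_levelPattern]
    simp only [Nat.succ_eq_add_one] at c1
    refine ⟨?_, ?_, ?_, ?_⟩ <;> omega

theorem boolInv_append (p q : List Bool) :
    boolInv (p ++ q) = boolInv p + boolInv q + p.count true * q.count false := by
  induction p with
  | nil => simp [boolInv]
  | cons b p ih =>
    cases b
    · simp [boolInv, ih]
    · simp [boolInv, ih]; ring

theorem wordInv_eq {l : ℕ} {w : List ℕ} (hw : ∀ x ∈ w, l ≤ x) :
    wordInv w = boolInv (levelPattern l w) + wordInv (lettersAbove l w) := by
  induction w with
  | nil => rfl
  | cons x w ih =>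
    have hx : l ≤ x := hw x (by simp)
    have hw' : ∀ x ∈ w, l ≤ x := fun y hy => hw y (by simp [hy])
    have ih := ih hw'
    have e := countP_lettersAbove hw' (fun y => decide (x = y + 1))
    rcases hx.lt_or_eq with hx | rfl
    · have e' : lettersAbove l (x :: w) = x :: lettersAbove l w := by simp [lettersAbove, hx]
      rw [e', wordInv, wordInv, levelPattern]
      by_cases hxl : x = l + 1
      · subst hxl
        simp [boolInv, count_false_levelPattern hw'] at e ⊢
        omega
      · have : ¬ x ≤ l + 1 := by omega
        simp [this, hxl] at e ⊢
        omega
    · have e' : lettersAbove l (l :: w) = lettersAbove l w := by simp [lettersAbove]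
      have e0 : w.countP (fun y => decide (l = y + 1)) = 0 :=
        List.countP_eq_zero.2 fun y hy => by
          have := hw' y hy
          simp; omega
      rw [e', wordInv, levelPattern]
      simp [boolInv, e0, ih]

theorem wordInv_levelPaths {f l : ℕ} {w : List ℕ} (h : IsLevelWord l w)
    (hb : ∀ x ∈ w, x < l + f) :
    wordInv w + (levelPaths f l w).2.count false * (levelPaths f l w).2.count true =
      boolInv (levelPaths f l w).1 + boolInv (levelPaths f l w).2 := by
  induction f generalizing l w with
  | zero => obtain rfl := eq_nil_of_bound h.le hb; simp [levelPaths, wordInv, boolInv]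
  | succ f ih =>
    have ih := ih h.lettersAbove (bound_lettersAbove hb)
    obtain ⟨h1, h2, h3, h4⟩ := count_levelPaths h.lettersAbove (bound_lettersAbove hb)
    have c1 := count_lettersAbove (Nat.lt_succ_self l) w
    rw [wordInv_eq h.le]
    simp only [levelPaths, boolInv_append, count_true_levelPattern]
    rw [Nat.succ_eq_add_one] at c1
    rw [c1] at h4
    rw [← h4] at h1
    rw [← h3] at h2
    rw [h1, h2]
    linear_combination ih

theorem append_cancel_of_head? {p p' q q' : List Bool} (hq : ∀ b ∈ q.head?, b = false)
    (hq' : ∀ b ∈ q'.head?, b = false) (hc : p.count false = p'.count false)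
    (h : p ++ q = p' ++ q') : p = p' ∧ q = q' := by
  induction p generalizing p' with
  | nil =>
    cases p' with
    | nil => simpa using h
    | cons b p' =>
      cases b
      · simp at hc
      · subst h
        simp at hq
  | cons b p ih =>
    cases p' with
    | nil =>
      cases b
      · simp at hc
      · subst h
        simp at hq'
    | cons b' p' =>
      simp only [List.cons_append, List.cons.injEq] at h
      obtain ⟨rfl, h⟩ := h
      have := ih (p' := p') (by simpa [List.count_cons] using hc) h
      simp [this]

theorem replicate_append_cancel_of_head? {a b : ℕ} {q q' : List Bool}
    (hq : ∀ b ∈ q.head?, b = false) (hq' : ∀ b ∈ q'.head?, b = false)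
    (h : List.replicate a true ++ q = List.replicate b true ++ q') : a = b ∧ q = q' := by
  have := append_cancel_of_head? hq hq' (by simp [List.count_replicate]) h
  simpa using And.imp_left (congrArg List.length) this

theorem eq_of_levelPattern_eq {l : ℕ} {w w' : List ℕ} (hw : ∀ x ∈ w, l ≤ x)
    (hw' : ∀ x ∈ w', l ≤ x) (hc : w.IsChain fun a b => b ≤ a + 1)
    (hc' : w'.IsChain fun a b => b ≤ a + 1) (hp : levelPattern l w = levelPattern l w')
    (ha : lettersAbove l w = lettersAbove l w') : w = w' := by
  have key : ∀ {w : List ℕ}, (∀ x ∈ w, l ≤ x) → (l :: w).IsChain (fun a b => b ≤ a + 1) →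
      ∀ x ∈ (lettersAbove l w).head?, x ≤ l + 1 := by
    intro w hw hc
    have := isChain_lettersAbove le_rfl hw hc
    rw [List.isChain_cons] at this
    exact this.1
  induction w generalizing w' with
  | nil =>
    cases w' with
    | nil => rfl
    | cons y w' =>
      have hy := hw' y (by simp)
      have : ¬ y ≤ l + 1 := fun h => by simp [levelPattern, h] at hp
      have : ¬ l < y := fun h => by simp [lettersAbove, h] at ha
      omega
  | cons x w ih =>
    have hx := hw x (by simp)
    cases w' with
    | nil =>
      have : ¬ x ≤ l + 1 := fun h => by simp [levelPattern, h] at hp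
      have : ¬ l < x := fun h => by simp [lettersAbove, h] at ha
      omega
    | cons y w' =>
      have hy := hw' y (by simp)
      have hw1 : ∀ x ∈ w, l ≤ x := fun z hz => hw z (by simp [hz])
      have hw1' : ∀ x ∈ w', l ≤ x := fun z hz => hw' z (by simp [hz])
      have ih := ih hw1 hw1' hc.tail hc'.tail
      have k1 := key hw1
      have k2 := key hw1'
      rcases lt_trichotomy x y with h | h | h
      · exfalso
        rcases hx.eq_or_lt with rfl | hx
        · rcases (Nat.succ_le_of_lt h).eq_or_lt with rfl | h
          · simp [levelPattern] at hp
          · have h1 : lettersAbove l (y :: w') = y :: lettersAbove l w' := by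
              simp [lettersAbove, show l < y by omega]
            have h2 : lettersAbove l (l :: w) = lettersAbove l w := by simp [lettersAbove]
            rw [h1, h2] at ha
            have := k1 hc y (by simp [ha])
            omega
        · simp [lettersAbove, hx, hx.trans h] at ha
          omega
      · subst h
        congr 1
        refine ih ?_ ?_
        · by_cases h : x ≤ l + 1 <;> simpa [levelPattern, h] using hp
        · by_cases h : l < x <;> simpa [lettersAbove, h] using ha
      · exfalso
        rcases hy.eq_or_lt with rfl | hy
        · rcases (Nat.succ_le_of_lt h).eq_or_lt with rfl | h
          · simp [levelPattern] at hp
          · have h1 : lettersAbove l (x :: w) = x :: lettersAbove l w := by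
              simp [lettersAbove, show l < x by omega]
            have h2 : lettersAbove l (l :: w') = lettersAbove l w' := by simp [lettersAbove]
            rw [h1, h2] at ha
            have := k2 hc' x (by simp [← ha])
            omega
        · simp [lettersAbove, hy, hy.trans h] at ha
          omega

theorem eq_of_levelPaths_eq {f l : ℕ} {w w' : List ℕ} (h : IsLevelWord l w)
    (h' : IsLevelWord l w') (hb : ∀ x ∈ w, x < l + f) (hb' : ∀ x ∈ w', x < l + f)
    (hc : w.count l = w'.count l) (hp : levelPaths f l w = levelPaths f l w') : w = w' := by
  induction f generalizing l w w' with
  | zero => rw [eq_nil_of_bound h.le hb, eq_nil_of_bound h'.le hb']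
  | succ f ih =>
    simp only [levelPaths, Prod.mk.injEq] at hp
    obtain ⟨hp1, hp2⟩ := hp
    obtain ⟨hA, hU⟩ := append_cancel_of_head? (head?_levelPaths_snd f h.lettersAbove)
      (head?_levelPaths_snd f h'.lettersAbove)
      (by rw [count_false_levelPattern h.le, count_false_levelPattern h'.le, hc]) hp1
    refine eq_of_levelPattern_eq h.le h'.le h.chain h'.chain hA ?_
    refine ih h.lettersAbove h'.lettersAbove (bound_lettersAbove hb) (bound_lettersAbove hb')
      ?_ (Prod.ext hp2 hU)
    rw [count_lettersAbove (Nat.lt_succ_self l), count_lettersAbove (Nat.lt_succ_self l),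
      Nat.succ_eq_add_one, ← count_true_levelPattern, ← count_true_levelPattern, hA]

theorem count_true_add_count_false (p : List Bool) :
    p.count true + p.count false = p.length := by
  induction p with
  | nil => rfl
  | cons b p ih => cases b <;> simp <;> omega

theorem count_take_le (p : List Bool) (b : Bool) (i : ℕ) : (p.take i).count b ≤ p.count b :=
  (List.take_sublist i p).count_le b

/-- The lattice path coded by the first component stays weakly below the path made of
`w.count l` north steps followed by the path coded by the second component. -/
theorem count_take_levelPaths_le {f l : ℕ} {w : List ℕ} (h : IsLevelWord l w)
    (hb : ∀ x ∈ w, x < l + f) (i : ℕ) :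
    ((levelPaths f l w).1.take i).count false ≤
      min i (w.count l) + ((levelPaths f l w).2.take (i - w.count l)).count true := by
  induction f generalizing l w i with
  | zero => simp [levelPaths]
  | succ f ih =>
    have ih := ih h.lettersAbove (bound_lettersAbove hb) (i - w.count l)
    obtain ⟨h1, h2, h3, h4⟩ := count_levelPaths h.lettersAbove (bound_lettersAbove hb)
    rw [count_lettersAbove (Nat.lt_succ_self l), Nat.succ_eq_add_one] at ih h4
    have cF := count_false_levelPattern h.le
    have cT := count_true_levelPattern (l := l) (w := w)
    simp only [levelPaths]
    generalize levelPattern l w = A at *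
    generalize (levelPaths f (l + 1) (lettersAbove l w)).1 = V at *
    generalize (levelPaths f (l + 1) (lettersAbove l w)).2 = U at *
    generalize w.count l = c at *
    generalize w.count (l + 1) = c' at *
    have hA := count_true_add_count_false A
    have hAi := count_take_le A false i
    have hi := count_true_add_count_false ((A ++ U).take i)
    have hli : ((A ++ U).take i).length ≤ i := by simp
    rw [List.take_append, List.count_append] at *
    rcases le_total i c with hic | hic
    · have : ((A.take i).count true + _) + _ = _ := hi
      rw [List.count_append] at hi
      omega
    rcases le_total i A.length with hiA | hiA
    · rw [Nat.sub_eq_zero_of_le hiA]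
      simp
      omega
    · have e : i - A.length = i - c - c' := by omega
      rw [List.take_of_length_le hiA, cF, e]
      have hU := count_take_le U false (i - c - c')
      have hUl := count_true_add_count_false (U.take (i - c - c'))
      have hVl := count_true_add_count_false (V.take (i - c))
      rw [List.length_take] at hUl hVl
      rcases le_total (i - c) V.length with hV | hV
      · omega
      · rw [List.take_of_length_le hV]
        omega

theorem truesUpTo_append (p q : List Bool) (z : ℕ) :
    truesUpTo (p ++ q) (p.count false + z) = p.count true + truesUpTo q z := by
  induction p with
  | nil => simp
  | cons b p ih =>
    cases b
    · simpa [truesUpTo, Nat.add_right_comm _ 1 z] using ih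
    · simp [truesUpTo, ih, Nat.add_right_comm]

theorem truesUpTo_zero {p : List Bool} (h : ∀ b ∈ p.head?, b = false) :
    truesUpTo p 0 = 0 := by
  rcases p with _ | ⟨_ | _, p⟩ <;> simp_all [truesUpTo]

theorem truesUpTo_levelPaths {f l : ℕ} {w : List ℕ} (h : IsLevelWord l w)
    (hb : ∀ x ∈ w, x < l + f) (j : ℕ) :
    truesUpTo (levelPaths f l w).1 (w.countP fun x => x % 2 = l % 2 ∧ x ≤ l + 2 * j) =
      (w.countP fun x => x % 2 = (l + 1) % 2 ∧ x ≤ l + 2 * j + 1) ∧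
    truesUpTo (levelPaths f l w).2
        (w.countP fun x => x % 2 = (l + 1) % 2 ∧ x ≤ l + 2 * j + 1) + w.count l =
      w.countP fun x => x % 2 = l % 2 ∧ x ≤ l + 2 * j + 2 := by
  induction f generalizing l w j with
  | zero => obtain rfl := eq_nil_of_bound h.le hb; simp [levelPaths, truesUpTo]
  | succ f ih =>
    have ih := ih h.lettersAbove (bound_lettersAbove hb)
    have hl : (l + 1 + 1) % 2 = l % 2 := by omega
    have hl' : ¬ l % 2 = (l + 1) % 2 := by omega
    simp only [hl, count_lettersAbove (Nat.lt_succ_self l)] at ih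
    have ev := fun K => countP_lettersAbove h.le (fun x => decide (x % 2 = l % 2 ∧ x ≤ l + K))
    have od := fun K =>
      countP_lettersAbove h.le (fun x => decide (x % 2 = (l + 1) % 2 ∧ x ≤ l + K))
    simp only [hl', false_and, decide_false, Bool.false_eq_true, if_false, add_zero, true_and,
      Nat.le_add_right, decide_true, if_true] at ev od
    have cF := count_false_levelPattern h.le
    have cT := count_true_levelPattern (l := l) (w := w)
    simp only [levelPaths]
    constructor
    · rw [ev, ← cF, add_comm (List.countP _ _), truesUpTo_append, add_assoc, od, cT]
      cases j with
      | zero =>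
        have e0 : ((lettersAbove l w).countP fun x => x % 2 = l % 2 ∧ x ≤ l + 2 * 0) = 0 :=
          List.countP_eq_zero.2 fun x hx => by
            have := h.lettersAbove.le x hx
            simp; omega
        have e1 : ((lettersAbove l w).countP fun x => x % 2 = (l + 1) % 2 ∧ x ≤ l + (2 * 0 + 1))
            = (lettersAbove l w).count (l + 1) :=
          List.countP_congr fun x hx => by
            have := h.lettersAbove.le x hx
            simp; omega
        rw [e0, e1, truesUpTo_zero (head?_levelPaths_snd f h.lettersAbove),
          count_lettersAbove (Nat.lt_succ_self l)]
        rfl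
      | succ j =>
        have := (ih j).2
        have a1 : l + 1 + 2 * j + 1 = l + 2 * (j + 1) := by ring
        have a2 : l + 1 + 2 * j + 2 = l + (2 * (j + 1) + 1) := by ring
        rw [a1, a2] at this
        rw [← this]
        simp [add_comm]
    · have := (ih j).1
      have a1 : l + 1 + 2 * j = l + (2 * j + 1) := by ring
      have a2 : l + 1 + 2 * j + 1 = l + (2 * j + 2) := by ring
      rw [a2, a1] at this
      rw [add_assoc, od, this, add_assoc, ev]

theorem valleysUpTo_zero (b : Bool) (p : List Bool) : valleysUpTo b p 0 = 0 := by
  induction p generalizing b with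
  | nil => simp [valleysUpTo]
  | cons c p ih => cases c <;> simp [valleysUpTo, ih]

theorem valleysUpTo_append {q : List Bool} (hq : ∀ b ∈ q.head?, b = false) (b : Bool)
    (p : List Bool) (z : ℕ) :
    valleysUpTo b (p ++ q) (p.count true + z) =
      valleysUpTo b p (p.count true) + valleysUpTo false q z := by
  induction p generalizing b with
  | nil => rcases q with _ | ⟨_ | _, q⟩ <;> simp_all [valleysUpTo]
  | cons c p ih =>
    cases c
    · simp [valleysUpTo, ih]
    · simp [valleysUpTo, ih, Nat.add_right_comm _ 1 z, add_assoc]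

theorem risesAux_eq (Q : ℕ → Bool) {l a : ℕ} {w : List ℕ} (ha : l ≤ a) (hw : ∀ x ∈ w, l ≤ x)
    (hc : (a :: w).IsChain fun a b => b ≤ a + 1) :
    risesAux Q a w =
      (if Q l then valleysUpTo (a = l) (levelPattern l w) ((levelPattern l w).count true)
        else 0) +
      if a = l then rises Q (lettersAbove l w) else risesAux Q a (lettersAbove l w) := by
  induction w generalizing a with
  | nil => simp [risesAux, rises, lettersAbove, levelPattern, valleysUpTo]
  | cons b w ih =>
    have hb : l ≤ b := hw b (by simp)
    have hw' : ∀ x ∈ w, l ≤ x := fun x hx => hw x (by simp [hx])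
    rw [List.isChain_cons_cons] at hc
    have ih := ih hb hw' hc.2
    rw [risesAux, ih]
    rcases hb.eq_or_lt with rfl | hb
    · have e1 : lettersAbove l (l :: w) = lettersAbove l w := by simp [lettersAbove]
      have e2 : levelPattern l (l :: w) = false :: levelPattern l w := by simp [levelPattern]
      have e3 : l ≠ a + 1 := by omega
      rw [e1, e2]
      simp only [e3, decide_false, Bool.false_and, Bool.toNat_false, zero_add, decide_true,
        if_true, valleysUpTo]
      have e4 : ¬ a = l → rises Q (lettersAbove l w) = risesAux Q a (lettersAbove l w) := by
        intro hal
        have := isChain_lettersAbove le_rfl hw' hc.2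
        rw [List.isChain_cons] at this
        have h2 := this.1
        generalize lettersAbove l w = v at h2
        cases v with
        | nil => rfl
        | cons x v =>
          have := h2 x (by simp)
          have : x ≠ a + 1 := by omega
          simp [rises, risesAux, this]
      split_ifs with h1 h2 h2 <;> simp_all
    · have e1 : lettersAbove l (b :: w) = b :: lettersAbove l w := by simp [lettersAbove, hb]
      have e5 : b ≠ l := by omega
      rw [e1]
      simp only [e5, decide_false, if_false]
      by_cases hbl : b = l + 1
      · have e2 : levelPattern l (b :: w) = true :: levelPattern l w := by
          simp [levelPattern, hbl]
        rw [e2]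
        rcases ha.eq_or_lt with rfl | ha
        · cases hQ : Q l <;> simp [valleysUpTo, hbl, rises, add_assoc]
        · have e3 : b ≠ a + 1 := by omega
          have e4 : a ≠ l := by omega
          cases hQ : Q l <;> simp [valleysUpTo, e3, e4, risesAux]
      · have e2 : levelPattern l (b :: w) = levelPattern l w := by
          have : ¬ b ≤ l + 1 := by omega
          simp [levelPattern, this]
        have e4 : a ≠ l := by omega
        rw [e2]
        simp only [e4, decide_false, if_false, risesAux]
        omega

theorem rises_eq (Q : ℕ → Bool) {l : ℕ} {w : List ℕ} (h : IsLevelWord l w) :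
    rises Q w =
      (if Q l then valleysUpTo false (levelPattern l w) ((levelPattern l w).count true)
        else 0) + rises Q (lettersAbove l w) := by
  cases w with
  | nil => simp [rises, lettersAbove, levelPattern, valleysUpTo]
  | cons a w =>
    obtain rfl : a = l := h.head a (by simp)
    rw [rises, risesAux_eq Q le_rfl (fun x hx => h.le x (by simp [hx])) h.chain]
    simp [levelPattern, lettersAbove, valleysUpTo]

theorem rises_eq_zero {Q : ℕ → Bool} {w : List ℕ} (h : ∀ x ∈ w, Q x = false) :
    rises Q w = 0 := by
  have key : ∀ (w : List ℕ) (a : ℕ), Q a = false → (∀ x ∈ w, Q x = false) →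
      risesAux Q a w = 0 := by
    intro w
    induction w with
    | nil => simp [risesAux]
    | cons b w ih =>
      intro a ha hw
      simp [risesAux, ha, ih b (hw b (by simp)) fun x hx => hw x (by simp [hx])]
  cases w with
  | nil => rfl
  | cons a w => exact key w a (h a (by simp)) fun x hx => h x (by simp [hx])

theorem valleysUpTo_levelPaths {f l : ℕ} {w : List ℕ} (h : IsLevelWord l w)
    (hb : ∀ x ∈ w, x < l + f) (j : ℕ) :
    (∀ t, t = (w.countP fun x => x % 2 = (l + 1) % 2 ∧ x ≤ l + 2 * j + 1) →
      valleysUpTo false (levelPaths f l w).1 t =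
        rises (fun x => x % 2 = l % 2 ∧ x ≤ l + 2 * j) w) ∧
    ∀ t, t + w.count l = (w.countP fun x => x % 2 = l % 2 ∧ x ≤ l + 2 * j) →
      valleysUpTo false (levelPaths f l w).2 t =
        rises (fun x => x % 2 = (l + 1) % 2 ∧ x + 1 ≤ l + 2 * j) w := by
  induction f generalizing l w j with
  | zero => obtain rfl := eq_nil_of_bound h.le hb; simp [levelPaths, valleysUpTo, rises]
  | succ f ih =>
    have ih := ih h.lettersAbove (bound_lettersAbove hb)
    have hl : (l + 1 + 1) % 2 = l % 2 := by omega
    have hl' : ¬ l % 2 = (l + 1) % 2 := by omega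
    simp only [hl, count_lettersAbove (Nat.lt_succ_self l)] at ih
    have cF := count_false_levelPattern h.le
    have cT := count_true_levelPattern (l := l) (w := w)
    simp only [levelPaths]
    constructor
    · intro t ht
      have e := countP_lettersAbove h.le
        (fun x => decide (x % 2 = (l + 1) % 2 ∧ x ≤ l + 2 * j + 1))
      have a1 : l + 1 + 2 * j = l + 2 * j + 1 := by ring
      simp only [hl', false_and, decide_false, Bool.false_eq_true, if_false, add_zero] at e
      have hle : w.count (l + 1) ≤ t := by
        rw [ht, List.count]
        refine List.countP_mono_left fun x _ hx => ?_
        simp at hx ⊢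
        omega
      obtain ⟨z, rfl⟩ := Nat.exists_eq_add_of_le hle
      have := (ih j).2 z (by rw [a1, ← e, ← ht, add_comm])
      rw [← cT, valleysUpTo_append (head?_levelPaths_snd f h.lettersAbove), this, rises_eq _ h]
      simp only [true_and, Nat.le_add_right, decide_true, if_true]
      congr 2
      funext x
      simp only [decide_eq_decide]
      omega
    · intro t ht
      cases j with
      | zero =>
        have e0 : (w.countP fun x => x % 2 = l % 2 ∧ x ≤ l + 2 * 0) = w.count l :=
          List.countP_congr fun x hx => by
            have := h.le x hx
            simp; omega
        obtain rfl : t = 0 := by omega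
        rw [valleysUpTo_zero, rises_eq_zero]
        intro x hx
        have := h.le x hx
        simp; omega
      | succ j =>
        have e := countP_lettersAbove h.le
          (fun x => decide (x % 2 = l % 2 ∧ x ≤ l + 2 * (j + 1)))
        simp only [true_and, Nat.le_add_right, decide_true, if_true] at e
        have a1 : l + 1 + 2 * j + 1 = l + 2 * (j + 1) := by ring
        have := (ih j).1 t (by rw [a1]; omega)
        rw [this, rises_eq _ h]
        simp only [hl', false_and, decide_false, Bool.false_eq_true, if_false, zero_add]
        congr 1
        funext x
        simp only [decide_eq_decide]
        omega

/- ## Area words -/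

/-- The area word read off the sequence of pairs of red and green steps, starting where the
red path is `d` units above the green one. -/
def pairsWord : ℕ → List (Bool × Bool) → List ℕ
  | _, [] => []
  | d, (true, true) :: s => (2 * d + 1) :: pairsWord d s
  | d, (true, false) :: s => (2 * d + 1) :: (2 * d + 2) :: pairsWord (d + 1) s
  | d, (false, false) :: s => (2 * d) :: pairsWord d s
  | d, (false, true) :: s => pairsWord (d - 1) s

/-- The red path stays weakly above the green one when starting `d` units above it. -/
def PairsAbove (d : ℕ) (s : List (Bool × Bool)) : Prop :=
  ∀ i, ((s.take i).map Prod.snd).count true ≤ d + ((s.take i).map Prod.fst).count true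

theorem PairsAbove.tail {d : ℕ} {r g : Bool} {s : List (Bool × Bool)}
    (h : PairsAbove d ((r, g) :: s)) :
    g.toNat ≤ d + r.toNat ∧ PairsAbove (d + r.toNat - g.toNat) s := by
  have h1 : g.toNat ≤ d + r.toNat := by
    have := h 1
    cases r <;> cases g <;> simp at this ⊢; exact this
  refine ⟨h1, fun i => ?_⟩
  have := h (i + 1)
  cases r <;> cases g <;> simp at this h1 ⊢ <;> omega

theorem areaWordAux_eq_pairsWord {d : ℕ} {s : List (Bool × Bool)} (h : PairsAbove d s) :
    areaWordAux (2 * d + 1) ((s.map fun p => [p.1, !p.2]).flatten ++ [false]) =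
      pairsWord d s := by
  induction s generalizing d with
  | nil => rfl
  | cons p s ih =>
    obtain ⟨r, g⟩ := p
    obtain ⟨h1, h2⟩ := h.tail
    have ih := ih h2
    cases r <;> cases g
    · simp [areaWordAux, pairsWord] at ih ⊢
      exact ih
    · have e : 2 * d - 1 = 2 * (d - 1) + 1 := by simp at h1; omega
      simpa [areaWordAux, pairsWord, e] using ih
    · simpa [areaWordAux, pairsWord, Nat.mul_add] using ih
    · simpa [areaWordAux, pairsWord] using ih

theorem isChain_pairsWord {a d : ℕ} {s : List (Bool × Bool)} (h : PairsAbove d s)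
    (ha : 2 * d ≤ a) : (a :: pairsWord d s).IsChain fun a b => b ≤ a + 1 := by
  induction s generalizing a d with
  | nil => simp [pairsWord]
  | cons p s ih =>
    obtain ⟨r, g⟩ := p
    obtain ⟨h1, h2⟩ := h.tail
    cases r <;> cases g <;>
      simp only [pairsWord, Bool.toNat_true, Bool.toNat_false, List.isChain_cons_cons,
        Nat.add_sub_cancel, add_zero, Nat.sub_zero] at h1 h2 ⊢
    · exact ⟨by omega, ih h2 le_rfl⟩
    · exact ih h2 (by omega)
    · exact ⟨by omega, by omega, ih h2 (by omega)⟩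
    · exact ⟨by omega, ih h2 (by omega)⟩

theorem pairsWord_injective {d : ℕ} {s s' : List (Bool × Bool)} (h : PairsAbove d s)
    (h' : PairsAbove d s') (hl : s.length = s'.length) (hw : pairsWord d s = pairsWord d s') :
    s = s' := by
  induction s generalizing d s' with
  | nil => exact (List.length_eq_zero_iff.1 hl.symm).symm
  | cons p s ih =>
    rcases s' with _ | ⟨p', s'⟩
    · simp at hl
    simp only [List.length_cons, Nat.add_right_cancel_iff] at hl
    have head : ∀ {d : ℕ} {s : List (Bool × Bool)}, PairsAbove d s →
        ∀ x ∈ (pairsWord d s).head?, x ≤ 2 * d + 1 := fun h =>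
      (List.isChain_cons.1 (isChain_pairsWord h le_rfl)).1
    obtain ⟨r, g⟩ := p
    obtain ⟨r', g'⟩ := p'
    obtain ⟨h1, h2⟩ := h.tail
    obtain ⟨h1', h2'⟩ := h'.tail
    have k := head h2
    have k' := head h2'
    cases r <;> cases g <;> cases r' <;> cases g' <;>
      simp only [pairsWord, Bool.toNat_true, Bool.toNat_false, List.cons.injEq, true_and,
        Nat.add_sub_cancel, add_zero, Nat.sub_zero] at h1 h2 h1' h2' k k' hw ⊢
    all_goals first
      | exact ih h2 h2' hl hw
      | exact ih h2 h2' hl hw.2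
      | (exfalso; omega)
      | (exfalso; rw [hw] at k; simp at k; done)
      | (exfalso; rw [hw] at k; simp at k; omega)
      | (exfalso; rw [← hw] at k'; simp at k'; done)
      | (exfalso; rw [← hw] at k'; simp at k'; omega)

theorem count_pairsWord {d : ℕ} {s : List (Bool × Bool)} :
    (pairsWord d s).countP (fun x => x % 2 = 1) = (s.map Prod.fst).count true ∧
    (pairsWord d s).countP (fun x => x % 2 = 0) = (s.map Prod.snd).count false := by
  induction s generalizing d with
  | nil => simp [pairsWord]
  | cons p s ih =>
    obtain ⟨_ | _, _ | _⟩ := p <;> simp [pairsWord, ih]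

theorem sum_pairsWord {d : ℕ} {s : List (Bool × Bool)} (h : PairsAbove d s)
    (hd : (s.map Prod.snd).count true = (s.map Prod.fst).count true + d) :
    ((pairsWord d s).map fun x => x / 2).sum + boolInv ((s.map Prod.fst).map not) =
      boolInv ((s.map Prod.snd).map not) + (s.map Prod.fst).count true * d := by
  induction s generalizing d with
  | nil => simp [pairsWord]
  | cons p s ih =>
    obtain ⟨r, g⟩ := p
    obtain ⟨h1, h2⟩ := h.tail
    have ih := ih h2
    have hnot : ∀ p : List Bool, (p.map not).count false = p.count true := fun p => by
      induction p with
      | nil => rfl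
      | cons b p ih => cases b <;> simp [ih]
    have e1 : (2 * d + 1) / 2 = d := by omega
    have e2 : (2 * d + 2) / 2 = d + 1 := by omega
    have e3 : 2 * d / 2 = d := by omega
    cases r <;> cases g <;>
      simp only [pairsWord, Bool.toNat_true, Bool.toNat_false, List.map_cons, Bool.not_false,
        Bool.not_true, boolInv, List.sum_cons, List.count_cons_self, e1, e2, e3, hnot,
        Nat.add_sub_cancel, add_zero, Nat.sub_zero, ne_eq, reduceCtorEq,
        not_false_eq_true, List.count_cons_of_ne] at h1 h2 ih hd ⊢
    · have := ih hd
      rw [hd]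
      linarith
    · obtain ⟨e, rfl⟩ : ∃ e, d = e + 1 := ⟨d - 1, by omega⟩
      simp only [Nat.add_sub_cancel] at ih ⊢
      have := ih (by omega)
      linarith
    · have := ih (by omega)
      rw [hd]
      linarith
    · have := ih (by omega)
      linarith

/- ## Finite sets of positions and lists -/

theorem card_filter_range_succ' (N : ℕ) (Q : ℕ → Prop) [DecidablePred Q] :
    ((range (N + 1)).filter Q).card =
      ((range N).filter fun i => Q (i + 1)).card + if Q 0 then 1 else 0 := by
  rw [card_filter, sum_range_succ', card_filter]

theorem card_filter_eq_count {N : ℕ} (p : Fin N → Bool) (b : Bool) :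
    (univ.filter fun i => p i = b).card = (List.ofFn p).count b := by
  induction N with
  | zero => simp
  | succ N ih =>
    rw [Fin.card_filter_univ_succ', List.ofFn_succ, List.count_cons, ← ih, add_comm]
    simp

theorem card_filter_lt_eq_count {N : ℕ} (p : Fin N → Bool) (i : ℕ) (b : Bool) :
    (univ.filter fun j : Fin N => (j : ℕ) < i ∧ p j = b).card =
      ((List.ofFn p).take i).count b := by
  induction N generalizing i with
  | zero => simp
  | succ N ih =>
    cases i with
    | zero => simp
    | succ i =>
      rw [Fin.card_filter_univ_succ', List.ofFn_succ, List.take_succ_cons, List.count_cons,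
        ← ih, add_comm]
      simp

theorem card_filter_le_eq_count {N : ℕ} (p : Fin N → Bool) (i : Fin N) :
    (univ.filter fun j => j ≤ i ∧ p j = true).card =
      ((List.ofFn p).take (i + 1)).count true := by
  rw [← card_filter_lt_eq_count]
  simp only [Fin.le_def, Nat.lt_succ_iff]

theorem truesBefore_succ {N : ℕ} (p : Fin (N + 1) → Bool) (j : Fin N) :
    truesBefore p j.succ = (p 0).toNat + truesBefore (fun i => p i.succ) j := by
  rw [truesBefore, Fin.card_filter_univ_succ', truesBefore]
  cases p 0 <;> simp

theorem falsesBefore_succ {N : ℕ} (p : Fin (N + 1) → Bool) (j : Fin N) :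
    falsesBefore p j.succ = (!p 0).toNat + falsesBefore (fun i => p i.succ) j := by
  rw [falsesBefore, Fin.card_filter_univ_succ', falsesBefore]
  cases p 0 <;> simp

theorem heightAt_eq {N : ℕ} (p : Fin N → Bool) (x : ℕ) :
    heightAt p x = truesUpTo (List.ofFn p) x := by
  induction N generalizing x with
  | zero => simp [heightAt, truesUpTo]
  | succ N ih =>
    have h0 : falsesBefore p 0 = 0 := by simp [falsesBefore]
    rw [heightAt, Fin.card_filter_univ_succ', List.ofFn_succ]
    simp only [falsesBefore_succ, h0]
    cases h : p 0
    · cases x with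
      | zero => simp [truesUpTo]
      | succ x =>
        rw [truesUpTo, ← ih, heightAt]
        simp [add_comm 1]
    · rw [truesUpTo, ← ih, heightAt]
      simp [add_comm 1]

theorem falsesBefore_not {N : ℕ} (p : Fin N → Bool) (j : Fin N) :
    falsesBefore (fun i => !p i) j = truesBefore p j := by
  simp [falsesBefore, truesBefore]

theorem xcoordAt_eq {N : ℕ} (p : Fin N → Bool) (y : ℕ) :
    xcoordAt p y = truesUpTo ((List.ofFn p).map not) y := by
  have : (List.ofFn p).map not = List.ofFn fun i => !p i := by simp [Function.comp_def]
  rw [this, ← heightAt_eq, heightAt, xcoordAt]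
  simp [falsesBefore_not]

theorem card_valleys_eq {N : ℕ} (p : Fin N → Bool) (b : Bool) (t : ℕ) :
    (univ.filter fun j : Fin N => (p j = true ∧ (((j : ℕ) = 0 ∧ b = true) ∨
      ∃ i : Fin N, (i : ℕ) + 1 = j ∧ p i = false)) ∧ truesBefore p j < t).card =
      valleysUpTo b (List.ofFn p) t := by
  induction N generalizing b t with
  | zero => simp [valleysUpTo]
  | succ N ih =>
    have h0 : truesBefore p 0 = 0 := by simp [truesBefore]
    rw [Fin.card_filter_univ_succ', List.ofFn_succ]
    simp only [truesBefore_succ, h0, Fin.exists_fin_succ]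
    cases h : p 0
    · rw [valleysUpTo, ← ih]
      simp
    · cases t with
      | zero => simp [valleysUpTo]
      | succ t =>
        rw [valleysUpTo, ← ih]
        cases b <;> simp [add_comm 1]

theorem wordInv_eq_card (w : List ℕ) :
    ((range w.length ×ˢ range w.length).filter
      fun p => p.1 < p.2 ∧ w.getD p.1 0 = w.getD p.2 0 + 1).card = wordInv w := by
  have key : ∀ (w : List ℕ) (Q : ℕ → Prop) [DecidablePred Q],
      ((range w.length).filter fun j => Q (w.getD j 0)).card = w.countP Q := by
    intro w Q _
    induction w with
    | nil => simp
    | cons x w ih =>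
      rw [List.length_cons, card_filter_range_succ', List.countP_cons, ← ih]
      simp
  rw [card_filter, sum_product]
  induction w with
  | nil => simp [wordInv]
  | cons x w ih =>
    rw [List.length_cons, sum_range_succ', wordInv, ← ih, add_comm, ← key]
    congr 1
    · rw [← card_filter, card_filter_range_succ']
      simp
    · refine sum_congr rfl fun i _ => ?_
      rw [sum_range_succ']
      simp

theorem card_rises_eq (Q : ℕ → Bool) (w : List ℕ) :
    ((range w.length).filter fun d => 0 < d ∧ w.getD d 0 = w.getD (d - 1) 0 + 1 ∧
      Q (w.getD (d - 1) 0)).card = rises Q w := by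
  have key : ∀ (w : List ℕ) (a : ℕ), ((range w.length).filter fun d =>
      w.getD d 0 = (a :: w).getD d 0 + 1 ∧ Q ((a :: w).getD d 0)).card = risesAux Q a w := by
    intro w
    induction w with
    | nil => simp [risesAux]
    | cons b w ih =>
      intro a
      rw [List.length_cons, card_filter_range_succ', risesAux, ← ih, add_comm]
      congr 1
      by_cases h : b = a + 1 <;> cases h' : Q a <;> simp [h, h']
  cases w with
  | nil => simp [rises]
  | cons a w =>
    rw [List.length_cons, card_filter_range_succ', rises, ← key]
    simp

theorem sum_getD_eq (w : List ℕ) :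
    ∑ i ∈ range w.length, w.getD i 0 / 2 = (w.map fun c => c / 2).sum := by
  induction w with
  | nil => simp
  | cons x w ih =>
    rw [List.length_cons, sum_range_succ', List.map_cons, List.sum_cons, ← ih, add_comm]
    simp

theorem card_filter_lt_succ {α : Type*} (S : Finset α) (f : α → ℕ) (v : ℕ) :
    (S.filter fun a => f a < v + 1).card =
      (S.filter fun a => f a < v).card + (S.filter fun a => f a = v).card := by
  classical
  rw [← card_union_of_disjoint, ← filter_or]
  · simp only [Nat.lt_succ_iff_lt_or_eq]
  · exact disjoint_filter.2 fun a _ h1 h2 => by omega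

/-- Two finite sets with equidistributed weights are related by a weight-preserving
bijection. -/
theorem exists_bijOn_of_card_filter_le_eq {α β : Type*} [Inhabited β] (S : Finset α)
    (T : Finset β) (f : α → ℕ) (g : β → ℕ)
    (h : ∀ v, (S.filter fun a => f a < v).card = (T.filter fun b => g b < v).card) :
    ∃ F : α → β, Set.BijOn F S T ∧ ∀ a ∈ S, g (F a) = f a := by
  classical
  have hv : ∀ v, (S.filter fun a => f a = v).card = (T.filter fun b => g b = v).card := by
    intro v
    have h1 := h v
    have h2 := h (v + 1)
    rw [card_filter_lt_succ, card_filter_lt_succ] at h2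
    omega
  let e : ∀ v, (S.filter fun a => f a = v) ≃ (T.filter fun b => g b = v) :=
    fun v => equivOfCardEq (hv v)
  let F : α → β := fun a =>
    if ha : a ∈ S then (e (f a) ⟨a, mem_filter.2 ⟨ha, rfl⟩⟩ : β) else default
  have hF : ∀ a (ha : a ∈ S), F a ∈ T ∧ g (F a) = f a := by
    intro a ha
    have := (e (f a) ⟨a, mem_filter.2 ⟨ha, rfl⟩⟩).2
    simp only [F, dif_pos ha]
    exact mem_filter.1 this
  have hFe : ∀ v a (ha : a ∈ S.filter fun a => f a = v), F a = e v ⟨a, ha⟩ := by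
    intro v a ha
    obtain ⟨ha', rfl⟩ := mem_filter.1 ha
    simp only [F, dif_pos ha']
  refine ⟨F, ⟨fun a ha => (hF a ha).1, ?_, ?_⟩, fun a ha => (hF a ha).2⟩
  · intro a ha b hb hab
    have hfb : f b = f a := by rw [← (hF a ha).2, ← (hF b hb).2, hab]
    rw [hFe (f a) a (mem_filter.2 ⟨ha, rfl⟩), hFe (f a) b (mem_filter.2 ⟨hb, hfb⟩)] at hab
    simpa using hab
  · intro b hb
    have hb' : b ∈ T.filter fun b' => g b' = g b := mem_filter.2 ⟨hb, rfl⟩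
    refine ⟨(e (g b)).symm ⟨b, hb'⟩, (mem_filter.1 ((e (g b)).symm ⟨b, hb'⟩).2).1, ?_⟩
    rw [hFe (g b) _ ((e (g b)).symm ⟨b, hb'⟩).2]
    simp

theorem count_map_not (p : List Bool) (b : Bool) : (p.map not).count b = p.count (!b) := by
  induction p with
  | nil => rfl
  | cons a p ih => cases a <;> cases b <;> simp_all

theorem boolInv_add_boolInv_map_not (p : List Bool) :
    boolInv p + boolInv (p.map not) = p.count true * p.count false := by
  induction p with
  | nil => rfl
  | cons b p ih =>
    cases b <;> simp [boolInv, count_map_not] <;> linarith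

namespace RedPoly

variable {m n : ℕ}

/-- The sequence of pairs of red and green steps. -/
def steps (P : RedPoly m n) : List (Bool × Bool) := List.ofFn fun i => (P.red i, P.green i)

theorem map_fst_steps (P : RedPoly m n) : P.steps.map Prod.fst = List.ofFn P.red := by
  simp [steps, Function.comp_def]

theorem map_snd_steps (P : RedPoly m n) : P.steps.map Prod.snd = List.ofFn P.green := by
  simp [steps, Function.comp_def]

theorem count_true_red (P : RedPoly m n) : (List.ofFn P.red).count true = n := by
  rw [← card_filter_eq_count, P.red_count]

theorem count_true_green (P : RedPoly m n) : (List.ofFn P.green).count true = n := by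
  rw [← card_filter_eq_count, P.green_count]

theorem count_false_green (P : RedPoly m n) : (List.ofFn P.green).count false = m := by
  have := count_true_add_count_false (List.ofFn P.green)
  rw [count_true_green, List.length_ofFn] at this
  omega

theorem pairsAbove_steps (P : RedPoly m n) : PairsAbove 0 P.steps := by
  intro i
  rw [List.map_take, List.map_take, map_fst_steps, map_snd_steps, zero_add]
  have key : ∀ i, i < m + n → ((List.ofFn P.green).take (i + 1)).count true ≤
      ((List.ofFn P.red).take (i + 1)).count true := fun i hi => by
    have := P.green_le_red ⟨i, hi⟩
    rwa [card_filter_le_eq_count, card_filter_le_eq_count] at this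
  rcases i with _ | i
  · simp
  · rcases lt_or_ge i (m + n) with hi | hi
    · exact key i hi
    · rw [List.take_of_length_le (by simp; omega), List.take_of_length_le (by simp; omega),
        count_true_red, count_true_green]

theorem areaWord_eq (P : RedPoly m n) : areaWord P = 0 :: pairsWord 0 P.steps := by
  have := areaWordAux_eq_pairsWord P.pairsAbove_steps
  rw [areaWord, interlaced, areaWordAux, ← this]
  simp [steps, List.map_ofFn, Function.comp_def]

theorem isLevelWord_areaWord (P : RedPoly m n) : IsLevelWord 0 (areaWord P) := by
  rw [areaWord_eq]
  exact ⟨fun x _ => x.zero_le, isChain_pairsWord P.pairsAbove_steps le_rfl, by simp⟩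

theorem areaWord_injective : Function.Injective (areaWord : RedPoly m n → List ℕ) := by
  intro P P' h
  rw [areaWord_eq, areaWord_eq, List.cons.injEq] at h
  have hs := pairsWord_injective P.pairsAbove_steps P'.pairsAbove_steps (by simp [steps]) h.2
  have hr : P.red = P'.red := List.ofFn_injective (by
    rw [← map_fst_steps, ← map_fst_steps, hs])
  have hg : P.green = P'.green := List.ofFn_injective (by
    rw [← map_snd_steps, ← map_snd_steps, hs])
  cases P
  cases P'
  simp_all

theorem countP_odd_areaWord (P : RedPoly m n) :
    (areaWord P).countP (fun x => x % 2 = 1) = n := by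
  rw [areaWord_eq, List.countP_cons, count_pairsWord.1, map_fst_steps, count_true_red]
  simp

theorem countP_even_areaWord (P : RedPoly m n) :
    (areaWord P).countP (fun x => x % 2 = 0) = m + 1 := by
  rw [areaWord_eq, List.countP_cons, count_pairsWord.2, map_snd_steps, count_false_green]
  simp

theorem count_zero_areaWord_pos (P : RedPoly m n) : 0 < (areaWord P).count 0 := by
  simp [areaWord_eq]

theorem length_areaWord (P : RedPoly m n) : (areaWord P).length = m + n + 1 := by
  have h1 := P.countP_odd_areaWord
  have h2 := P.countP_even_areaWord
  have := List.length_eq_countP_add_countP (fun x => decide (x % 2 = 1)) (l := areaWord P)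
  have e : (areaWord P).countP (fun x => !decide (x % 2 = 1)) =
      (areaWord P).countP (fun x => decide (x % 2 = 0)) :=
    List.countP_congr fun x _ => by simp
  simp only [decide_not, decide_eq_true_eq] at this
  omega

theorem lt_length_of_isChain {h : ℕ} {w : List ℕ} (hc : w.IsChain fun a b => b ≤ a + 1)
    (hh : ∀ x ∈ w.head?, x ≤ h) : ∀ x ∈ w, x < h + w.length := by
  induction w generalizing h with
  | nil => simp
  | cons a w ih =>
    rw [List.isChain_cons] at hc
    have ha : a ≤ h := hh a (by simp)
    have := ih hc.2 (h := h + 1) fun x hx => (hc.1 x hx).trans (by omega)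
    intro x hx
    rcases List.mem_cons.1 hx with rfl | hx
    · simp; omega
    · have := this x hx
      simp; omega

theorem lt_of_mem_areaWord (P : RedPoly m n) : ∀ x ∈ areaWord P, x < 0 + (m + n + 1) := by
  have h := P.isLevelWord_areaWord
  rw [← P.length_areaWord]
  exact lt_length_of_isChain h.chain fun x hx => (h.head x hx).le

theorem areaStat_eq (P : RedPoly m n) :
    areaStat P + boolInv ((List.ofFn P.red).map not) = boolInv ((List.ofFn P.green).map not) := by
  have := sum_pairsWord P.pairsAbove_steps (by
    rw [map_fst_steps, map_snd_steps, count_true_red, count_true_green, add_zero])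
  rw [map_fst_steps, map_snd_steps] at this
  rw [areaStat, areaWord_eq, ← add_zero (boolInv ((List.ofFn P.green).map not))]
  simpa using this

theorem dinvStat_eq (P : RedPoly m n) : dinvStat P = wordInv (areaWord P) :=
  wordInv_eq_card _

theorem exists_of_lists {R G : List Bool} (hR : R.length = m + n) (hG : G.length = m + n)
    (hRn : R.count true = n) (hGn : G.count true = n)
    (h : ∀ i, (G.take i).count true ≤ (R.take i).count true) :
    ∃ P : RedPoly m n, List.ofFn P.red = R ∧ List.ofFn P.green = G := by
  have key : ∀ L : List Bool, L.length = m + n →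
      List.ofFn (fun i : Fin (m + n) => L.getD i false) = L := fun L hL =>
    List.ext_getElem (by simp [hL]) fun i h1 h2 => by simp [h2]
  refine ⟨⟨fun i => R.getD i false, fun i => G.getD i false, ?_, ?_, fun i => ?_⟩,
    key R hR, key G hG⟩
  · rw [card_filter_eq_count, key R hR, hRn]
  · rw [card_filter_eq_count, key G hG, hGn]
  · rw [card_filter_le_eq_count, card_filter_le_eq_count, key R hR, key G hG]
    exact h _

/-- `P` is the polyomino whose paths are the concatenated level patterns of the area word
of `Q`. -/
def IsZetaPair (P : RedPoly m n) (Q : RedPoly n m) : Prop :=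
  List.ofFn P.red = List.replicate ((areaWord Q).count 0 - 1) true ++
    (levelPaths (n + m + 1) 0 (areaWord Q)).2 ∧
  false :: (List.ofFn P.green).map not = (levelPaths (n + m + 1) 0 (areaWord Q)).1

theorem exists_isZetaPair (Q : RedPoly n m) : ∃ P : RedPoly m n, IsZetaPair P Q := by
  have hl := Q.isLevelWord_areaWord
  have hb := Q.lt_of_mem_areaWord
  obtain ⟨h1, h2, h3, h4⟩ := count_levelPaths hl hb
  have hd := count_take_levelPaths_le hl hb
  have hV := head?_levelPaths_fst (n + m + 1) hl
  have hpos := Q.count_zero_areaWord_pos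
  simp only [Nat.zero_mod, zero_add, Nat.one_mod, Q.countP_odd_areaWord,
    Q.countP_even_areaWord] at h1 h2 h3 h4
  unfold IsZetaPair
  generalize (levelPaths (n + m + 1) 0 (areaWord Q)).1 = V at *
  generalize (levelPaths (n + m + 1) 0 (areaWord Q)).2 = U at *
  generalize (areaWord Q).count 0 = c at *
  rcases V with _ | ⟨b, G⟩
  · simp at h1
  obtain rfl : b = false := hV b (by simp)
  have hGl := count_true_add_count_false G
  have hUl := count_true_add_count_false U
  simp at h1 h2
  obtain ⟨P, hP1, hP2⟩ := exists_of_lists (m := m) (n := n)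
    (R := List.replicate (c - 1) true ++ U) (G := G.map not) (by simp; omega) (by simp; omega)
    (by simp; omega) (by simp [count_map_not, h1]) (fun i => by
      have := hd (i + 1)
      rw [← List.map_take, count_map_not, List.take_append, List.count_append]
      have e : i - (c - 1) = i + 1 - c := by omega
      simp [List.take_replicate, e] at this ⊢
      omega)
  refine ⟨P, hP1, ?_⟩
  rw [hP2, List.map_map]
  simp [Function.comp_def]

theorem IsZetaPair.eq {P : RedPoly m n} {Q Q' : RedPoly n m} (h : IsZetaPair P Q)
    (h' : IsZetaPair P Q') : Q = Q' := by
  have hl := Q.isLevelWord_areaWord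
  have hl' := Q'.isLevelWord_areaWord
  have hp := Q.count_zero_areaWord_pos
  have hp' := Q'.count_zero_areaWord_pos
  obtain ⟨hc, hU⟩ := replicate_append_cancel_of_head? (head?_levelPaths_snd _ hl)
    (head?_levelPaths_snd _ hl') (h.1.symm.trans h'.1)
  exact areaWord_injective (eq_of_levelPaths_eq hl hl' Q.lt_of_mem_areaWord
    Q'.lt_of_mem_areaWord (by omega) (Prod.ext (h.2.symm.trans h'.2) hU))

instance : Finite (RedPoly m n) :=
  Finite.of_injective (fun P : RedPoly m n => (P.red, P.green)) fun P P' h => by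
    cases P
    cases P'
    simp_all

theorem exists_equiv (m n : ℕ) :
    ∃ e : RedPoly m n ≃ RedPoly n m, ∀ P, IsZetaPair P (e P) := by
  choose F hF using fun Q : RedPoly n m => exists_isZetaPair Q
  choose G hG using fun Q : RedPoly m n => exists_isZetaPair Q
  have hFi : Function.Injective F := fun Q Q' h => (hF Q).eq (h ▸ hF Q')
  have hGi : Function.Injective G := fun Q Q' h => (hG Q).eq (h ▸ hG Q')
  have hFb : Function.Bijective F :=
    hFi.bijective_of_nat_card_le (Nat.card_le_card_of_injective G hGi)
  let e := Equiv.ofBijective F hFb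
  refine ⟨e.symm, fun P => ?_⟩
  have : F (e.symm P) = P := e.apply_symm_apply P
  simpa only [this] using hF (e.symm P)

theorem IsZetaPair.dinvStat_eq {P : RedPoly m n} {Q : RedPoly n m} (h : IsZetaPair P Q) :
    dinvStat Q = areaStat P := by
  have key := wordInv_levelPaths Q.isLevelWord_areaWord Q.lt_of_mem_areaWord
  have hA := P.areaStat_eq
  have hU := boolInv_add_boolInv_map_not (levelPaths (n + m + 1) 0 (areaWord Q)).2
  have h0 : ∀ a, boolInv (List.replicate a false) = 0 := fun a => by
    induction a with
    | zero => rfl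
    | succ a ih => simpa [List.replicate_succ, boolInv] using ih
  rw [← h.2, boolInv] at key
  rw [h.1, List.map_append, boolInv_append] at hA
  simp only [List.map_replicate, Bool.not_true, h0, List.count_replicate, zero_add, beq_iff_eq,
    Bool.false_eq_true, if_false, zero_mul, add_zero] at hA
  rw [Q.dinvStat_eq]
  linarith

end RedPoly

theorem sum_card_filter_le (N n : ℕ) (Y : ℕ → ℕ) :
    ∑ y ∈ range n, ((range N).filter fun k => Y k ≤ y).card = ∑ k ∈ range N, (n - Y k) := by
  simp only [card_filter]
  rw [sum_comm]
  refine sum_congr rfl fun k _ => ?_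
  rw [← card_filter, ← Nat.card_Ico]
  congr 1
  ext y
  simp [and_comm]

theorem sum_countP_lt (N : ℕ) (Q : ℕ → Bool) {w : List ℕ} (hw : ∀ x ∈ w, x / 2 ≤ N) :
    ∑ k ∈ range N, w.countP (fun x => Q x ∧ k < x / 2) =
      (w.map fun x => if Q x then x / 2 else 0).sum := by
  induction w with
  | nil => simp
  | cons x w ih =>
    have hx : x / 2 ≤ N := hw x (by simp)
    have hc : ((range N).filter fun k => k < x / 2) = range (x / 2) := by
      ext k
      simp
      omega
    simp only [List.countP_cons, sum_add_distrib, List.map_cons, List.sum_cons]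
    rw [ih fun y hy => hw y (by simp [hy]), add_comm]
    congr 1
    cases Q x <;> simp [hc]

/-- For a monotone sequence, the number of terms at most `y` is at most `v` iff the term of
index `v` exceeds `y`. -/
theorem card_filter_le_lt_iff {N v y : ℕ} {Y : ℕ → ℕ} (hY : Monotone Y)
    (hv : N ≤ v → y < Y v) : ((range N).filter fun k => Y k ≤ y).card < v + 1 ↔ y < Y v := by
  constructor
  · contrapose!
    intro h
    have hvN : v < N := by
      by_contra hc
      exact absurd (hv (by omega)) (by omega)
    calc v + 1 = (range (v + 1)).card := (card_range _).symm
      _ ≤ _ := card_le_card fun k hk => by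
        rw [mem_range] at hk
        exact mem_filter.2 ⟨mem_range.2 (by omega), (hY (by omega)).trans h⟩
  · intro h
    refine Nat.lt_succ_of_le ((card_le_card fun k hk => ?_).trans (card_range v).le)
    rw [mem_filter] at hk
    by_contra hc
    have := hY (not_lt.1 fun hkv => hc (mem_range.2 hkv))
    omega

namespace RedPoly

variable {m n : ℕ} {P : RedPoly m n} {Q : RedPoly n m}

theorem IsZetaPair.bouncePt_succ (h : IsZetaPair P Q) (k : ℕ) :
    (bouncePt P (k + 1)).2 + 1 =
      (areaWord Q).countP (fun x => x % 2 = 0 ∧ x ≤ 2 * k) ∧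
    (bouncePt P (k + 1)).1 =
      (areaWord Q).countP (fun x => x % 2 = 1 ∧ x ≤ 2 * k + 1) := by
  have key := truesUpTo_levelPaths Q.isLevelWord_areaWord Q.lt_of_mem_areaWord
  simp only [Nat.zero_mod, zero_add, Nat.one_mod] at key
  have hpos := Q.count_zero_areaWord_pos
  have hheight : ∀ x, heightAt P.red x + 1 =
      truesUpTo (levelPaths (n + m + 1) 0 (areaWord Q)).2 x + (areaWord Q).count 0 := by
    intro x
    have := truesUpTo_append (List.replicate ((areaWord Q).count 0 - 1) true)
      (levelPaths (n + m + 1) 0 (areaWord Q)).2 x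
    simp [List.count_replicate] at this
    rw [heightAt_eq, h.1, this]
    omega
  have hcoord : ∀ y, xcoordAt P.green y =
      truesUpTo (levelPaths (n + m + 1) 0 (areaWord Q)).1 (y + 1) := by
    intro y
    rw [xcoordAt_eq, ← h.2, truesUpTo]
  have hstep : ∀ k, (bouncePt P (k + 1)).2 + 1 =
        (areaWord Q).countP (fun x => x % 2 = 0 ∧ x ≤ 2 * k) →
      (bouncePt P (k + 1)).1 =
        (areaWord Q).countP (fun x => x % 2 = 1 ∧ x ≤ 2 * k + 1) := by
    intro k hk
    rw [← (key k).1, ← hk, bouncePt, hcoord]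
  suffices h2 : (bouncePt P (k + 1)).2 + 1 =
      (areaWord Q).countP (fun x => x % 2 = 0 ∧ x ≤ 2 * k) from ⟨h2, hstep k h2⟩
  induction k with
  | zero =>
    rw [bouncePt, hheight, bouncePt,
      truesUpTo_zero (head?_levelPaths_snd _ Q.isLevelWord_areaWord), zero_add, List.count]
    exact List.countP_congr fun x _ => by simp; omega
  | succ k ih =>
    rw [bouncePt, hheight, hstep k ih, (key k).2]
    rfl

theorem IsZetaPair.monotone_bouncePt (h : IsZetaPair P Q) :
    Monotone fun k => (bouncePt P (k + 1)).2 := by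
  intro a b hab
  have ha := (h.bouncePt_succ a).1
  have hb := (h.bouncePt_succ b).1
  have : (areaWord Q).countP (fun x => x % 2 = 0 ∧ x ≤ 2 * a) ≤
      (areaWord Q).countP (fun x => x % 2 = 0 ∧ x ≤ 2 * b) :=
    List.countP_mono_left fun x _ => by simp; omega
  show (bouncePt P (a + 1)).2 ≤ (bouncePt P (b + 1)).2
  omega

theorem IsZetaPair.vertLabel_lt_iff (h : IsZetaPair P Q) {y : ℕ} (hy : y < n) (v : ℕ) :
    vertLabel P y < v + 1 ↔ y < (bouncePt P (v + 1)).2 := by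
  refine card_filter_le_lt_iff h.monotone_bouncePt fun hv => ?_
  have h1 := (h.bouncePt_succ v).1
  have h2 : (areaWord Q).countP (fun x => x % 2 = 0 ∧ x ≤ 2 * v) =
      (areaWord Q).countP (fun x => x % 2 = 0) := List.countP_congr fun x hx => by
    have := Q.lt_of_mem_areaWord x hx
    simp; omega
  rw [Q.countP_even_areaWord] at h2
  omega

theorem IsZetaPair.zeroLabelCount_add_one (h : IsZetaPair P Q) :
    zeroLabelCount P + 1 = (areaWord Q).count 0 := by
  have h0 := (h.bouncePt_succ 0).1
  have e : ((range n).filter fun y => vertLabel P y = 0) = range (bouncePt P 1).2 := by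
    have hle : (areaWord Q).countP (fun x => x % 2 = 0 ∧ x ≤ 2 * 0) ≤
      (areaWord Q).countP (fun x => x % 2 = 0) := List.countP_mono_left fun x _ => by simp; omega
    rw [Q.countP_even_areaWord, ← h0] at hle
    rw [zero_add] at hle
    ext y
    rw [mem_filter, mem_range, mem_range]
    constructor
    · rintro ⟨hy, hv⟩
      exact (h.vertLabel_lt_iff hy 0).1 (by omega)
    · intro hy
      have hyn : y < n := by omega
      have := (h.vertLabel_lt_iff hyn 0).2 hy
      exact ⟨hyn, by omega⟩
  rw [zeroLabelCount, e, card_range, h0, List.count]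
  exact List.countP_congr fun x _ => by simp; omega

theorem IsZetaPair.bounceStat_eq (h : IsZetaPair P Q) : bounceStat P = areaStat Q := by
  have hN : ∀ x ∈ areaWord Q, x / 2 ≤ m + n := fun x hx => by
    have := Q.lt_of_mem_areaWord x hx
    omega
  have hcount : ∀ (w : List ℕ) (b k : ℕ), w.countP (fun x => x % 2 = b) =
      w.countP (fun x => x % 2 = b ∧ x ≤ 2 * k + b) +
        w.countP (fun x => decide (x % 2 = b) ∧ k < x / 2) := by
    intro w b k
    induction w with
    | nil => rfl
    | cons x w ih =>
      simp only [List.countP_cons, ih]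
      by_cases h1 : x % 2 = b
      · by_cases h2 : x ≤ 2 * k + b
        · have : ¬ k < x / 2 := by omega
          simp [h1, h2, this]; omega
        · have : k < x / 2 := by omega
          simp [h1, h2, this]; omega
      · simp [h1]
  have hv : ∑ y ∈ range n, vertLabel P y = ∑ k ∈ range (m + n),
      (areaWord Q).countP (fun x => decide (x % 2 = 0) ∧ k < x / 2) := by
    unfold vertLabel
    rw [sum_card_filter_le]
    refine sum_congr rfl fun k _ => ?_
    have h1 := (h.bouncePt_succ k).1
    have h2 : (areaWord Q).countP (fun x => x % 2 = 0) =
        (areaWord Q).countP (fun x => x % 2 = 0 ∧ x ≤ 2 * k) +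
          (areaWord Q).countP (fun x => decide (x % 2 = 0) ∧ k < x / 2) := hcount _ 0 k
    rw [Q.countP_even_areaWord] at h2
    omega
  have hh : ∑ x ∈ range m, horLabel P x = ∑ k ∈ range (m + n),
      (areaWord Q).countP (fun x => decide (x % 2 = 1) ∧ k < x / 2) := by
    unfold horLabel
    rw [sum_card_filter_le]
    refine sum_congr rfl fun k _ => ?_
    have h1 := (h.bouncePt_succ k).2
    have h2 := hcount (areaWord Q) 1 k
    rw [Q.countP_odd_areaWord] at h2
    omega
  rw [bounceStat, hv, hh, sum_countP_lt _ _ hN, sum_countP_lt _ _ hN, ← List.sum_map_add,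
    areaStat]
  congr 1
  refine List.map_congr_left fun x _ => ?_
  rcases Nat.mod_two_eq_zero_or_one x with hx | hx <;> simp [hx]

theorem rowOf_lt {j : Fin (m + n)} (hj : P.red j = true) : rowOf P j < n := by
  conv_rhs => rw [← P.red_count]
  unfold rowOf truesBefore
  refine card_lt_card (ssubset_iff.2 ⟨j, by simp, fun i hi => ?_⟩)
  rw [mem_insert] at hi
  rcases hi with rfl | hi
  · simpa using hj
  · exact mem_filter.2 ⟨mem_univ _, (mem_filter.1 hi).2.2⟩

theorem rowOf_injOn : Set.InjOn (rowOf P) {j | P.red j = true} := by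
  have key : ∀ i j : Fin (m + n), P.red i = true → i < j → rowOf P i < rowOf P j := by
    intro i j hi hij
    unfold rowOf truesBefore
    refine card_lt_card (ssubset_iff.2 ⟨i, by simp, fun l hl => ?_⟩)
    rw [mem_insert] at hl
    rcases hl with rfl | hl
    · exact mem_filter.2 ⟨mem_univ _, hij, hi⟩
    · obtain ⟨_, h1, h2⟩ := mem_filter.1 hl
      exact mem_filter.2 ⟨mem_univ _, h1.trans hij, h2⟩
  intro i hi j hj hij
  rcases lt_trichotomy i j with h | h | h
  · exact absurd hij (key i j hi h).ne
  · exact h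
  · exact absurd hij (key j i hj h).ne'

open Classical in
theorem IsZetaPair.card_valleys_eq_card_rises (h : IsZetaPair P Q) (v : ℕ) :
    ((univ.filter (IsRedValley P)).filter fun j => vertLabel P (rowOf P j) < v).card =
      (((range (areaWord Q).length).filter (IsRise (areaWord Q))).filter
        fun d => (areaWord Q).getD d 0 / 2 < v).card := by
  rcases v with _ | v
  · simp
  have hpos := Q.count_zero_areaWord_pos
  have hE := (h.bouncePt_succ v).1
  have hU := head?_levelPaths_snd (n + m + 1) Q.isLevelWord_areaWord
  have hle : (areaWord Q).count 0 ≤ (bouncePt P (v + 1)).2 + 1 := by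
    rw [hE]
    exact List.countP_mono_left fun x _ => by simp; omega
  have hr := (valleysUpTo_levelPaths Q.isLevelWord_areaWord Q.lt_of_mem_areaWord v).2
    ((bouncePt P (v + 1)).2 + 1 - (areaWord Q).count 0) (by
      simp only [Nat.zero_mod, zero_add]
      omega)
  have hrep : ∀ a t, valleysUpTo false (List.replicate a true) t = 0 := by
    intro a
    induction a with
    | zero => intro t; rfl
    | succ a ih => intro t; cases t <;> simp [List.replicate_succ, valleysUpTo, ih]
  have happ := valleysUpTo_append hU false (List.replicate ((areaWord Q).count 0 - 1) true)
    ((bouncePt P (v + 1)).2 + 1 - (areaWord Q).count 0)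
  rw [hrep, zero_add, hr, ← h.1, List.count_replicate_self, show (areaWord Q).count 0 - 1 +
    ((bouncePt P (v + 1)).2 + 1 - (areaWord Q).count 0) = (bouncePt P (v + 1)).2 by omega,
    ← card_valleys_eq, ← card_rises_eq] at happ
  convert happ using 2
  · ext j
    simp only [mem_filter, mem_univ, true_and, IsRedValley]
    constructor
    · rintro ⟨⟨h1, h2⟩, h3⟩
      exact ⟨⟨h1, .inr h2⟩, (h.vertLabel_lt_iff (rowOf_lt h1) v).1 h3⟩
    · rintro ⟨⟨h1, h2⟩, h3⟩
      exact ⟨⟨h1, by simpa using h2⟩, (h.vertLabel_lt_iff (rowOf_lt h1) v).2 h3⟩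
  · ext d
    simp only [mem_filter, mem_range, IsRise]
    generalize (areaWord Q).getD d 0 = a
    generalize (areaWord Q).getD (d - 1) 0 = b
    simp
    omega

open Classical in
theorem IsZetaPair.exists_bijOn (h : IsZetaPair P Q) :
    ∃ F : Fin (m + n) → ℕ, Set.BijOn F {j | IsRedValley P j} {d | IsRise (areaWord Q) d} ∧
      ∀ j, IsRedValley P j → (areaWord Q).getD (F j) 0 / 2 = vertLabel P (rowOf P j) := by
  obtain ⟨F, hF, hF'⟩ := exists_bijOn_of_card_filter_le_eq _ _ _ _ h.card_valleys_eq_card_rises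
  refine ⟨F, ?_, fun j hj => hF' j (by simpa using hj)⟩
  convert hF using 1
  · ext j
    simp
  · ext d
    simpa using fun hd : IsRise (areaWord Q) d => hd.2.1

end RedPoly

theorem uArea_add_sum {m n k : ℕ} (R : RiseDecorated m n k) :
    uArea R + ∑ d ∈ R.marks, (areaWord R.poly).getD d 0 / 2 = areaStat R.poly := by
  rw [uArea, sum_sdiff, sum_getD_eq, areaStat]
  exact fun d hd => mem_range.2 (R.marks_rise d hd).2.1

theorem uBounce_add_sum {m n k : ℕ} (R : ValleyDecorated m n k) :
    uBounce R + ∑ j ∈ R.marks, vertLabel R.poly (rowOf R.poly j) = bounceStat R.poly := by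
  have hsub : R.marks.image (rowOf R.poly) ⊆ range n := fun y hy => by
    obtain ⟨j, hj, rfl⟩ := mem_image.1 hy
    exact mem_range.2 (RedPoly.rowOf_lt (R.marks_valley j hj).1)
  rw [uBounce, bounceStat, ← sum_sdiff hsub, sum_image]
  · ring
  · exact RedPoly.rowOf_injOn.mono fun j hj => (R.marks_valley j hj).1

theorem stmt2 (m n k : ℕ) (hm : 1 ≤ m) (hn : 1 ≤ n) :
    ∃ ζ : ValleyDecorated m n k ≃ RiseDecorated n m k,
      ∀ P : ValleyDecorated m n k,
        dinvStat (ζ P).poly = areaStat P.poly ∧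
        uArea (ζ P) = uBounce P ∧
        (areaWord (ζ P).poly).count 0 = zeroLabelCount P.poly + 1 := by
  obtain ⟨e, he⟩ := RedPoly.exists_equiv m n
  choose F hF hFv using fun P => (he P).exists_bijOn
  let Z : ValleyDecorated m n k → RiseDecorated n m k := fun R =>
    { poly := e R.poly
      marks := R.marks.image (F R.poly)
      marks_card := by
        rw [card_image_of_injOn ((hF R.poly).injOn.mono fun j hj => R.marks_valley j hj),
          R.marks_card]
      marks_rise := fun d hd => by
        obtain ⟨j, hj, rfl⟩ := mem_image.1 hd
        exact (hF R.poly).mapsTo (R.marks_valley j hj) }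
  classical
  have hZ : Function.Bijective Z := by
    constructor
    · rintro ⟨P, M, hM, hM'⟩ ⟨P', M', hk, hk'⟩ h
      simp only [Z, RiseDecorated.mk.injEq, EmbeddingLike.apply_eq_iff_eq] at h
      obtain ⟨rfl, h⟩ := h
      congr
      rw [← coe_inj, coe_image, coe_image] at h
      exact coe_injective (((hF P).injOn.image_eq_image_iff hM' hk').1 h)
    · rintro ⟨Q, M, hM, hM'⟩
      obtain ⟨P, rfl⟩ := e.surjective Q
      have hS : (univ.filter fun j => IsRedValley P j ∧ F P j ∈ M).image (F P) = M := by
        ext d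
        rw [mem_image]
        constructor
        · rintro ⟨j, hj, rfl⟩
          exact (mem_filter.1 hj).2.2
        · intro hd
          obtain ⟨j, hj, rfl⟩ := (hF P).surjOn (hM' d hd)
          exact ⟨j, mem_filter.2 ⟨mem_univ _, hj, hd⟩, rfl⟩
      refine ⟨⟨P, univ.filter fun j => IsRedValley P j ∧ F P j ∈ M, ?_, fun j hj =>
        (mem_filter.1 hj).2.1⟩, ?_⟩
      · rw [← hM, ← hS, card_image_of_injOn ((hF P).injOn.mono fun j hj => ?_), hS]
        exact (mem_filter.1 hj).2.1
      · simp only [Z, hS]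
  refine ⟨Equiv.ofBijective Z hZ, fun R => ?_⟩
  have h := he R.poly
  refine ⟨h.dinvStat_eq, ?_, h.zeroLabelCount_add_one.symm⟩
  have h1 := uArea_add_sum (Z R)
  have h2 := uBounce_add_sum R
  have h3 : ∑ d ∈ (Z R).marks, (areaWord (Z R).poly).getD d 0 / 2 =
      ∑ j ∈ R.marks, vertLabel R.poly (rowOf R.poly j) := by
    simp only [Z]
    rw [sum_image ((hF R.poly).injOn.mono fun j hj => R.marks_valley j hj)]
    exact sum_congr rfl fun j hj => hFv R.poly j (R.marks_valley j hj)
  have h4 : areaStat (Z R).poly = bounceStat R.poly := h.bounceStat_eq.symm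
  show uArea (Z R) = uBounce R
  omega
end
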